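/- For n ≥ 4, the monoid DPS_n of all partial isometries of the star graph S_n is defined by the monoid presentation ⟨A | R⟩ on the 5 generators A = {a₁,a₂,b₁,b₂,c} with the 3n+9 relations R. Precisely, the quotient of the free monoid A* by the smallest congruence containing R is isomorphic to DPS_n, via the isomorphism induced by the homomorphism φ : A* → DPS_n extending a₁ ↦ α₁, a₂ ↦ α₂, b₁ ↦ β₁, b₂ ↦ β₂, c ↦ γ. -/

import Mathlib

namespace DPSPaper

instance instMonoidPFun {V : Type*} : Monoid (V →. V) where
  mul f g := g.comp f
  one := PFun.id V
  mul_assoc a b c := (PFun.comp_assoc c b a).symm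
  one_mul := PFun.comp_id
  mul_one := PFun.id_comp

/-- The geodesic distance in the star graph `S_n` on vertices `{0,1,...,n-1}`. -/
def starDist (n : ℕ) (x y : Fin n) : ℕ :=
  if x = y then 0 else if (x : ℕ) = 0 ∨ (y : ℕ) = 0 then 1 else 2

/-- Injectivity of a partial map. -/
def PInj {n : ℕ} (α : Fin n →. Fin n) : Prop :=
  ∀ ⦃x y a : Fin n⦄, a ∈ α x → a ∈ α y → x = y

/-- `α` is a partial isometry of the star graph `S_n`. -/
def IsStarPI {n : ℕ} (α : Fin n →. Fin n) : Prop :=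
  PInj α ∧ ∀ ⦃x y u v : Fin n⦄, u ∈ α x → v ∈ α y → starDist n u v = starDist n x y

/-- The set of all partial isometries of `S_n`. -/
def DPSset (n : ℕ) : Set (Fin n →. Fin n) := { α | IsStarPI α }

/-- `α₁` : fixes 0, sends `i ↦ i+1` for `1 ≤ i ≤ n-2`, and `n-1 ↦ 1`. -/
def alphaOne (n : ℕ) (hn : 3 ≤ n) : Fin n →. Fin n :=
  fun x => Part.some <|
    if (x : ℕ) = 0 then x
    else if h : (x : ℕ) = n - 1 then ⟨1, by omega⟩
    else ⟨(x : ℕ) + 1, by have := x.isLt; omega⟩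

/-- `α₂` : fixes 0 and every `i ≥ 3`, swaps 1 and 2. -/
def alphaTwo (n : ℕ) (hn : 3 ≤ n) : Fin n →. Fin n :=
  fun x => Part.some <|
    if (x : ℕ) = 1 then ⟨2, by omega⟩
    else if (x : ℕ) = 2 then ⟨1, by omega⟩
    else x

/-- `β₁` : the partial identity on `{0,1,...,n-2}`. -/
def betaOne (n : ℕ) : Fin n →. Fin n :=
  fun x => if (x : ℕ) ≤ n - 2 then Part.some x else Part.none

/-- `β₂` : the partial identity on `{1,...,n-1}`. -/
def betaTwo (n : ℕ) : Fin n →. Fin n :=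
  fun x => if (x : ℕ) = 0 then Part.none else Part.some x

/-- `γ` : domain `{0,1}`, sending `0 ↦ 1` and `1 ↦ 0`. -/
def gammaMap (n : ℕ) (hn : 3 ≤ n) : Fin n →. Fin n :=
  fun x =>
    if (x : ℕ) = 0 then Part.some ⟨1, by omega⟩
    else if (x : ℕ) = 1 then Part.some ⟨0, by omega⟩
    else Part.none

/-- The five-letter alphabet `A = {a₁, a₂, b₁, b₂, c}`. -/
inductive Gen : Type
  | a1 | a2 | b1 | b2 | c
deriving DecidableEq

abbrev W := FreeMonoid Gen

def wa1 : W := FreeMonoid.of Gen.a1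
def wa2 : W := FreeMonoid.of Gen.a2
def wb1 : W := FreeMonoid.of Gen.b1
def wb2 : W := FreeMonoid.of Gen.b2
def wc  : W := FreeMonoid.of Gen.c

/-- The set `R` of `3n+9` defining relations over the alphabet `A`. -/
def Rrel (n : ℕ) : W → W → Prop := fun u v =>
  (u = wa2 ^ 2 ∧ v = 1) ∨
  (u = wa1 ^ (n - 1) ∧ v = 1) ∨
  (u = (wa1 * wa2) ^ (n - 2) ∧ v = 1) ∨
  (u = (wa2 * wa1 ^ (n - 2) * wa2 * wa1) ^ 3 ∧ v = 1) ∨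
  (∃ j, 2 ≤ j ∧ j ≤ n - 3 ∧ u = (wa2 * wa1 ^ (n - 1 - j) * wa2 * wa1 ^ j) ^ 2 ∧ v = 1) ∨
  (u = wb1 ^ 2 ∧ v = wb1) ∨
  (u = wb2 ^ 2 ∧ v = wb2) ∨
  (u = wa2 * wb1 ∧ v = wb1 * wa2) ∨
  (u = wb2 * wa2 ∧ v = wa2 * wb2) ∨
  (u = wb2 * wa1 ∧ v = wa1 * wb2) ∨
  (u = wb2 * wb1 ∧ v = wb1 * wb2) ∨
  (u = wa1 * wa2 * wa1 ^ (n - 2) * wb1 * wa1 * wa2 * wa1 ^ (n - 2) ∧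
    v = wa1 ^ (n - 2) * wb1 * wa1) ∨
  (u = (wa1 ^ (n - 2) * wb1 * wa1 * wa2) ^ 2 ∧ v = (wa2 * wa1 ^ (n - 2) * wb1 * wa1) ^ 2) ∨
  (u = wa1 ^ (n - 2) * wb1 * wa1 * wa2 * wa1 ^ (n - 2) * wb1 * wa1 ∧
    v = (wa2 * wa1 ^ (n - 2) * wb1 * wa1) ^ 2) ∨
  (u = wc ^ 3 ∧ v = wc) ∨
  (u = wc * wa1 ∧ v = wc * wa2) ∨
  (u = wa1 ^ (n - 2) * wc ∧ v = wa2 * wc) ∨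
  (∃ j, 1 ≤ j ∧ j ≤ n - 3 ∧ u = wa2 * wa1 ^ j * wc ∧ v = wa1 ^ j * wc) ∨
  (u = wb1 * wa1 * wc ∧ v = wc * wb2) ∨
  (∃ j, 2 ≤ j ∧ j ≤ n - 3 ∧ u = wb1 * wa1 ^ j * wc ∧ v = wa1 ^ j * wc) ∨
  (u = (wb1 * wa1) ^ (n - 3) * wb1 ∧ v = wc ^ 2 * wa2 * wa1 ^ (n - 4)) ∨
  (u = wb2 * wc ^ 2 ∧ v = wc * wa2 * wc) ∨
  (u = (wb2 * wc) ^ 2 ∧ v = wb2 * wc * wb2)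

/-- The images of the generators. -/
def genMap (n : ℕ) (hn : 3 ≤ n) : Gen → (Fin n →. Fin n)
  | Gen.a1 => alphaOne n hn
  | Gen.a2 => alphaTwo n hn
  | Gen.b1 => betaOne n
  | Gen.b2 => betaTwo n
  | Gen.c  => gammaMap n hn

/-- The homomorphism `φ : A* → DPS_n` extending `a₁ ↦ α₁, a₂ ↦ α₂, b₁ ↦ β₁, b₂ ↦ β₂, c ↦ γ`. -/
def phi (n : ℕ) (hn : 3 ≤ n) : W →* (Fin n →. Fin n) :=
  FreeMonoid.lift (genMap n hn)

/-- The number of occurrences of the letter `x` in the word `w`. -/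
def cnt (x : Gen) (w : W) : ℕ := (FreeMonoid.toList w).count x

open Equiv

section Cox
variable {G : Type*} [Group G]

/-- descending product `s (j+l-1) * ... * s j` -/
def dprod (s : ℕ → G) (j : ℕ) : ℕ → G
  | 0 => 1
  | l + 1 => s (j + l) * dprod s j l

theorem dprod_succ' (s : ℕ → G) (j l : ℕ) : dprod s j (l+1) = dprod s (j+1) l * s j := by
  induction l with
  | zero => simp [dprod]
  | succ l ih =>
    rw [dprod, ih, dprod, mul_assoc]
    congr 2
    ring

/-- the subgroup generated by the first `k` elements -/
def Hsub (s : ℕ → G) (k : ℕ) : Subgroup G := Subgroup.closure (s '' {i | i < k})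

theorem s_mem_Hsub (s : ℕ → G) {i k : ℕ} (h : i < k) : s i ∈ Hsub s k :=
  Subgroup.subset_closure ⟨i, h, rfl⟩

/-- commute past far elements -/
theorem dprod_comm_far (s : ℕ → G) (M : ℕ)
    (hcom : ∀ i j, i + 2 ≤ j → j < M → s i * s j = s j * s i)
    (j l i : ℕ) (hjl : j + l ≤ M) (hi : i + 2 ≤ j) : dprod s j l * s i = s i * dprod s j l := by
  induction l with
  | zero => simp [dprod]
  | succ l ih =>
    rw [dprod, mul_assoc, ih (by omega), ← mul_assoc, ← hcom i (j+l) (by omega) (by omega), mul_assoc]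

theorem dprod_braid (s : ℕ → G) (M : ℕ)
    (hbraid : ∀ i, i + 1 < M → s i * s (i+1) * s i = s (i+1) * s i * s (i+1))
    (hcom : ∀ i j, i + 2 ≤ j → j < M → s i * s j = s j * s i)
    (j l i : ℕ) (hjl : j + l ≤ M) (hi : j ≤ i) (hi2 : i + 1 < j + l) :
    dprod s j l * s (i+1) = s i * dprod s j l := by
  induction l with
  | zero => omega
  | succ l ih =>
    rcases Nat.lt_or_ge (i+1) (j+l) with h | h
    · rw [dprod, mul_assoc, ih (by omega) h, ← mul_assoc, ← hcom i (j+l) (by omega) (by omega), mul_assoc]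
    · obtain rfl : l = (i - j) + 1 := by omega
      have e1 : j + (i - j + 1) = i + 1 := by omega
      have e2 : j + (i-j) = i := by omega
      rw [dprod, dprod, e1, e2, mul_assoc, mul_assoc]
      have : dprod s j (i-j) * s (i+1) = s (i+1) * dprod s j (i-j) := by
        have : ∀ l, j + l ≤ i → dprod s j l * s (i+1) = s (i+1) * dprod s j l := by
          intro l
          induction l with
          | zero => simp [dprod]
          | succ l ih =>
            intro h
            rw [dprod, mul_assoc, ih (by omega), ← mul_assoc, hcom (j+l) (i+1) (by omega) (by omega), mul_assoc]
        exact this _ (by omega)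
      rw [this]
      simp only [← mul_assoc]
      rw [hbraid i (by omega)]

theorem cox_decomp (s : ℕ → G) (M : ℕ) (hsq : ∀ i, s i * s i = 1)
    (hbraid : ∀ i, i + 1 < M → s i * s (i+1) * s i = s (i+1) * s i * s (i+1))
    (hcom : ∀ i j, i + 2 ≤ j → j < M → s i * s j = s j * s i)
    (k : ℕ) (hk : k + 1 ≤ M) (h : G) (hh : h ∈ Hsub s (k+1)) :
    ∃ h' ∈ Hsub s k, ∃ j l, j + l = k + 1 ∧ h = h' * dprod s j l := by
  have hinv : ∀ i, (s i)⁻¹ = s i := fun i => inv_eq_of_mul_eq_one_left (hsq i)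
  have step : ∀ x : G, ∀ i, i < k + 1 → (∃ h' ∈ Hsub s k, ∃ j l, j + l = k + 1 ∧ x = h' * dprod s j l) →
      (∃ h' ∈ Hsub s k, ∃ j l, j + l = k + 1 ∧ x * s i = h' * dprod s j l) := by
    rintro x i hi ⟨h', hh', j, l, hjl, rfl⟩
    rcases lt_trichotomy i j with hij | rfl | hij
    · rcases Nat.lt_or_ge (i+1) j with h1 | h1
      · exact ⟨h' * s i, mul_mem hh' (s_mem_Hsub s (by omega)), j, l, hjl, by
          rw [mul_assoc, dprod_comm_far s M hcom _ _ _ (by omega) h1, mul_assoc]⟩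
      · obtain rfl : j = i + 1 := by omega
        exact ⟨h', hh', i, l+1, by omega, by rw [dprod_succ', mul_assoc]⟩
    · cases l with
      | zero => omega
      | succ l => exact ⟨h', hh', i+1, l, by omega, by
          rw [dprod_succ', mul_assoc, mul_assoc, hsq, mul_one]⟩
    · obtain ⟨i, rfl⟩ : ∃ i', i = i' + 1 := ⟨i - 1, by omega⟩
      exact ⟨h' * s i, mul_mem hh' (s_mem_Hsub s (by omega)), j, l, hjl, by
          rw [mul_assoc, dprod_braid s M hbraid hcom _ _ _ (by omega) (by omega) (by omega), mul_assoc]⟩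
  induction hh using Subgroup.closure_induction_right with
  | one => exact ⟨1, one_mem _, k+1, 0, rfl, by simp [dprod]⟩
  | mul_right x hx y hy ih =>
    obtain ⟨i, hi, rfl⟩ := hy
    exact step x i hi ih
  | mul_inv_cancel x hx y hy ih =>
    obtain ⟨i, hi, rfl⟩ := hy
    rw [hinv]
    exact step x i hi ih

theorem cox_inj {m : ℕ} (s : ℕ → G) (hsq : ∀ i, s i * s i = 1)
    (hbraid : ∀ i, i + 1 < m → s i * s (i+1) * s i = s (i+1) * s i * s (i+1))
    (hcom : ∀ i j, i + 2 ≤ j → j < m → s i * s j = s j * s i)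
    (f : G →* Perm (Fin (m+1)))
    (hf : ∀ i (hi : i < m), f (s i) = swap ⟨i, by omega⟩ ⟨i+1, by omega⟩)
    (k : ℕ) (hk : k ≤ m) (h : G) (hh : h ∈ Hsub s k) (hfh : f h = 1) : h = 1 := by
  have fixl : ∀ k, k ≤ m → ∀ h ∈ Hsub s k, ∀ x : Fin (m+1), k < x → f h x = x := by
    intro k hk h hh x hx
    induction hh using Subgroup.closure_induction with
    | mem y hy =>
      obtain ⟨i, hi, rfl⟩ := hy
      have hi' : i < k := hi
      rw [hf i (by omega)]
      apply swap_apply_of_ne_of_ne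
      · intro h; rw [h] at hx; simp at hx; omega
      · intro h; rw [h] at hx; simp at hx; omega
    | one => simp
    | mul a b _ _ ha hb => simp [ha, hb]
    | inv a _ ha => rw [map_inv, Perm.inv_eq_iff_eq, ha]
  have dact : ∀ j l (h : j + l ≤ m), f (dprod s j l) ⟨j, by omega⟩ = ⟨j+l, by omega⟩ := by
    intro j l
    induction l with
    | zero => simp [dprod]
    | succ l ih =>
      intro h
      rw [dprod, map_mul, Perm.mul_apply, ih (by omega), hf _ (by omega), swap_apply_left]
      rfl
  induction k generalizing h with
  | zero =>
    simpa [Hsub] using hh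
  | succ k ih =>
    obtain ⟨h', hh', j, l, hjl, rfl⟩ := cox_decomp s m hsq hbraid hcom k (by omega) h hh
    have h1 := congrArg (fun p : Perm (Fin (m+1)) => p ⟨j, by omega⟩) hfh
    simp only [map_mul, Perm.mul_apply, Perm.one_apply] at h1
    rw [dact j l (by omega), fixl k (by omega) h' hh' _ (by simp; omega)] at h1
    simp at h1
    subst h1
    simp only [dprod, mul_one] at hfh ⊢
    exact ih (by omega) h' hh' hfh dact

theorem moore_inj {k : ℕ} (r t : G) (h1 : t * t = 1) (h2 : r ^ (k+3) = 1)
    (h3 : (r * t) ^ (k+2) = 1) (h4 : (t * r ^ (k+2) * t * r) ^ 3 = 1)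
    (h5 : ∀ j, 2 ≤ j → j ≤ k+1 → (t * r ^ (k+3-j) * t * r ^ j) ^ 2 = 1)
    (f : G →* Perm (Fin (k+3))) (hfr : f r = (finRotate (k+3))⁻¹) (hft : f t = swap 0 1)
    (h : G) (hh : h ∈ Subgroup.closure {r, t}) (hfh : f h = 1) : h = 1 := by
  set s : ℕ → G := fun i => (r ^ i)⁻¹ * t * r ^ i with hs
  have hsq : ∀ i, s i * s i = 1 := by
    intro i
    have : s i * s i = (r ^ i)⁻¹ * (t * t) * r ^ i := by simp only [hs]; group
    rw [this, h1]; simp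
  have hinv : ∀ i, (s i)⁻¹ = s i := fun i => inv_eq_of_mul_eq_one_left (hsq i)
  have hrinv : ∀ j, j ≤ k + 3 → r ^ (k+3-j) = (r ^ j)⁻¹ := by
    intro j hj
    rw [eq_inv_iff_mul_eq_one, ← pow_add, Nat.sub_add_cancel hj, h2]
  have hconj : ∀ i d, s (i + d) = (r ^ i)⁻¹ * s d * r ^ i := by
    intro i d
    simp only [hs, add_comm i d, pow_add]
    group
  have hs0 : s 0 = t := by simp [hs]
  have b0 : s 0 * s 1 * s 0 = s 1 * s 0 * s 1 := by
    have e : (t * r ^ (k+2) * t * r) = s 0 * s 1 := by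
      have := hrinv 1 (by omega)
      rw [show k + 3 - 1 = k + 2 by omega] at this
      rw [this, hs0]; simp [hs, mul_assoc]
    rw [e] at h4
    have : s 0 * s 1 * s 0 * (s 1 * s 0 * s 1) = 1 := by
      rw [← h4]; simp only [pow_succ, pow_zero, one_mul, mul_assoc]
    rw [eq_inv_of_mul_eq_one_left this]
    simp only [mul_inv_rev, hinv, mul_assoc]
  have c0 : ∀ j, 2 ≤ j → j ≤ k + 1 → s 0 * s j = s j * s 0 := by
    intro j hj hj2
    have := h5 j hj hj2
    have e : (t * r ^ (k+3-j) * t * r ^ j) = s 0 * s j := by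
      rw [hrinv j (by omega), hs0]; simp [hs, mul_assoc]
    rw [e, pow_two] at this
    rw [eq_inv_of_mul_eq_one_left this]
    simp only [mul_inv_rev, hinv]
  have hbraid : ∀ i, i + 1 < k + 2 → s i * s (i+1) * s i = s (i+1) * s i * s (i+1) := by
    intro i _
    have e0 := hconj i 0
    rw [add_zero] at e0
    rw [e0, hconj i 1]
    have : ∀ a b : G, ((r ^ i)⁻¹ * a * r ^ i) * ((r ^ i)⁻¹ * b * r ^ i) * ((r ^ i)⁻¹ * a * r ^ i)
      = (r ^ i)⁻¹ * (a * b * a) * r ^ i := by intro a b; group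
    rw [this, this, b0]
  have hcom : ∀ i j, i + 2 ≤ j → j < k + 2 → s i * s j = s j * s i := by
    intro i j hij hj
    have e0 := hconj i 0
    rw [add_zero] at e0
    obtain ⟨d, rfl⟩ : ∃ d, j = i + d := ⟨j - i, by omega⟩
    rw [e0, hconj i d]
    have : ∀ a b : G, ((r ^ i)⁻¹ * a * r ^ i) * ((r ^ i)⁻¹ * b * r ^ i)
      = (r ^ i)⁻¹ * (a * b) * r ^ i := by intro a b; group
    rw [this, this, c0 d (by omega) (by omega)]
  have hrot : ∀ i (hi : i < k + 2), f (s i) = swap ⟨i, by omega⟩ ⟨i+1, by omega⟩ := by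
    intro i
    induction i with
    | zero => intro _; rw [hs0, hft]; rfl
    | succ i ih =>
      intro hi
      have : s (i+1) = r⁻¹ * s i * r := by
        rw [add_comm, hconj 1 i]; simp
      rw [this, map_mul, map_mul, map_inv, hfr, ih (by omega), inv_inv, ← Equiv.swap_apply_apply]
      congr 1
      · rw [finRotate_of_lt (by omega)]
      · rw [finRotate_of_lt (by omega)]
  have hprod : ∀ l, l ≤ k + 2 → (t * r⁻¹) ^ l * r ^ l ∈ Hsub s (k+2) := by
    intro l
    induction l with
    | zero => intro _; simp
    | succ l ih =>
      intro hl
      have : (t * r⁻¹) ^ (l+1) * r ^ (l+1) = ((t * r⁻¹) ^ l * r ^ l) * s l := by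
        simp only [hs, pow_succ (t * r⁻¹) l, pow_succ' r l]; group
      rw [this]
      exact mul_mem (ih (by omega)) (s_mem_Hsub s (by omega))
  have htm : t ∈ Hsub s (k+2) := by rw [← hs0]; exact s_mem_Hsub s (by omega)
  have hrm : r ∈ Hsub s (k+2) := by
    have e := hprod (k+2) le_rfl
    have e2 : (t * r⁻¹) = (r * t)⁻¹ := by
      rw [mul_inv_rev, inv_eq_of_mul_eq_one_left h1]
    rw [e2, inv_pow, h3, inv_one, one_mul] at e
    have := hrinv 1 (by omega)
    rw [show k + 3 - 1 = k + 2 by omega, pow_one] at this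
    rw [this] at e
    simpa using e
  have hh' : h ∈ Hsub s (k+2) := by
    refine (Subgroup.closure_le _).2 ?_ hh
    rintro x (rfl | rfl)
    · exact hrm
    · exact htm
  exact cox_inj s hsq hbraid hcom f hrot (k+2) le_rfl h hh' hfh

theorem perm_gen (k : ℕ) : Subgroup.closure {(finRotate (k+3))⁻¹, swap (0 : Fin (k+3)) 1} = ⊤ := by
  have := Equiv.Perm.closure_cycle_adjacent_swap (σ := finRotate (k+3)) isCycle_finRotate
    support_finRotate 0
  rw [eq_top_iff, ← this, Subgroup.closure_le]
  rintro x (rfl | rfl)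
  · rw [SetLike.mem_coe, ← inv_mem_iff]
    exact Subgroup.subset_closure (by simp)
  · exact Subgroup.subset_closure (by simp)

/-- Relations in the permutation group. -/
structure MRel {M : Type*} [Monoid M] (k : ℕ) (r t : M) : Prop where
  h1 : t * t = 1
  h2 : r ^ (k+3) = 1
  h3 : (r * t) ^ (k+2) = 1
  h4 : (t * r ^ (k+2) * t * r) ^ 3 = 1
  h5 : ∀ j, 2 ≤ j → j ≤ k+1 → (t * r ^ (k+3-j) * t * r ^ j) ^ 2 = 1

theorem pow_apply_aux {m : ℕ} (g : Perm (Fin m)) (lo : ℕ)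
    (hg : ∀ i (h : i + 1 < m), lo ≤ i → g ⟨i, by omega⟩ = ⟨i+1, h⟩)
    (j i : ℕ) (h : i + j < m) (hi : lo ≤ i) : (g ^ j) ⟨i, by omega⟩ = ⟨i+j, h⟩ := by
  induction j with
  | zero => simp
  | succ j ih => rw [pow_succ', Perm.mul_apply, ih (by omega), hg _ (by omega) (by omega)]; rfl

theorem pow_eq_aux {k : ℕ} (g : Perm (Fin (k+3))) (lo : ℕ) (hlo : lo ≤ 1)
    (hg : ∀ i (h : i + 1 < k+3), lo ≤ i → g ⟨i, by omega⟩ = ⟨i+1, h⟩)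
    (hlast : g ⟨k+2, by omega⟩ = ⟨lo, by omega⟩) (h0 : ∀ i : Fin (k+3), (i : ℕ) < lo → g i = i) :
    g ^ (k + 3 - lo) = 1 := by
  ext x
  obtain ⟨i, hi⟩ := x
  rcases Nat.lt_or_ge i lo with h | h
  · have e : ∀ j, (g ^ j) ⟨i, hi⟩ = ⟨i, hi⟩ := by
      intro j
      induction j with
      | zero => simp
      | succ j ih => rw [pow_succ', Perm.mul_apply, ih, h0 _ h]
    rw [e]; rfl
  · have e1 := pow_apply_aux g lo hg (k + 2 - i) i (by omega) h
    have e2 := pow_apply_aux g lo hg (i - lo) lo (by omega) le_rfl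
    have : k + 3 - lo = (i - lo) + 1 + (k + 2 - i) := by omega
    rw [this, pow_add, Perm.mul_apply, e1, pow_add, Perm.mul_apply, pow_one]
    have e3 : (⟨i + (k + 2 - i), by omega⟩ : Fin (k+3)) = ⟨k+2, by omega⟩ := by
      ext; simp; omega
    rw [e3, hlast, e2]
    simp; omega

theorem rot_lt (k : ℕ) (i : ℕ) (h : i + 1 < k + 3) :
    finRotate (k+3) ⟨i, by omega⟩ = ⟨i+1, h⟩ := finRotate_of_lt (by omega)

theorem rot_last' (k : ℕ) : finRotate (k+3) ⟨k+2, by omega⟩ = 0 := finRotate_last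

theorem rot_pow (k : ℕ) : (finRotate (k+3)) ^ (k+3) = 1 :=
  pow_eq_aux (finRotate (k+3)) 0 (by omega) (fun i h _ => rot_lt k i h) (rot_last' k)
    (fun i h => by omega)

theorem perm_rel (k : ℕ) : MRel k (finRotate (k+3))⁻¹ (swap (0 : Fin (k+3)) 1) := by
  have hrinv : ∀ j, j ≤ k + 3 → ((finRotate (k+3))⁻¹) ^ (k+3-j) = (finRotate (k+3)) ^ j := by
    intro j hj
    rw [inv_pow, inv_eq_iff_mul_eq_one, ← pow_add, Nat.sub_add_cancel hj, rot_pow]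
  have hconj : ∀ j (hj : j + 1 < k + 3), (finRotate (k+3))⁻¹ ^ (k+3-j) * swap (0 : Fin (k+3)) 1 *
      (finRotate (k+3))⁻¹ ^ j = swap ⟨j, by omega⟩ ⟨j+1, hj⟩ := by
    intro j hj
    have e0 := pow_apply_aux (finRotate (k+3)) 0 (fun i h _ => rot_lt k i h) j 0 (by omega) (by omega)
    have e1 := pow_apply_aux (finRotate (k+3)) 0 (fun i h _ => rot_lt k i h) j 1 (by omega) (by omega)
    rw [hrinv j (by omega), inv_pow, ← Equiv.swap_apply_apply]
    congr 1
    · refine e0.trans ?_; ext; simp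
    · refine e1.trans ?_; ext; simp; omega
  refine ⟨by simp, by rw [inv_pow, rot_pow, inv_one], ?_, ?_, ?_⟩
  · rw [← inv_inj, ← inv_pow, mul_inv_rev, inv_inv, swap_inv, inv_one]
    refine pow_eq_aux (k := k) _ 1 le_rfl ?_ ?_ ?_
    · intro i h hi
      rw [Perm.mul_apply, rot_lt k i h]
      apply swap_apply_of_ne_of_ne
      · simp [Fin.ext_iff]
      · simp [Fin.ext_iff]; omega
    · rw [Perm.mul_apply, rot_last', swap_apply_left]; rfl
    · intro i hi
      obtain rfl : i = 0 := Fin.ext (by rw [Fin.val_zero]; omega)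
      rw [Perm.mul_apply, show finRotate (k+3) 0 = 1 from rot_lt k 0 (by omega), swap_apply_right]
  · have := hconj 1 (by omega)
    rw [show k + 3 - 1 = k + 2 by omega, pow_one] at this
    rw [mul_assoc, mul_assoc, ← mul_assoc _ _ ((finRotate (k+3))⁻¹), this]
    have := (Equiv.Perm.isThreeCycle_swap_mul_swap_same (a := (⟨1, by omega⟩ : Fin (k+3)))
      (b := ⟨0, by omega⟩) (c := ⟨2, by omega⟩)
      (by simp [Fin.ext_iff]) (by simp [Fin.ext_iff]) (by simp [Fin.ext_iff]))
    have h := this.orderOf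
    have h' := pow_orderOf_eq_one (swap (⟨1, by omega⟩ : Fin (k+3)) ⟨0, by omega⟩ *
      swap ⟨1, by omega⟩ ⟨2, by omega⟩)
    rw [h, swap_comm] at h'
    exact h'
  · intro j hj hj2
    rw [mul_assoc, mul_assoc, ← mul_assoc _ _ ((finRotate (k+3))⁻¹ ^ j), hconj j (by omega), pow_two]
    have : swap (0 : Fin (k+3)) 1 * swap ⟨j, by omega⟩ ⟨j+1, by omega⟩ =
       swap ⟨j, by omega⟩ ⟨j+1, by omega⟩ * swap (0 : Fin (k+3)) 1 := by
      apply (Equiv.Perm.disjoint_iff_disjoint_support.2 _).commute.eq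
      rw [Equiv.Perm.support_swap, Equiv.Perm.support_swap]
      · simp only [Finset.disjoint_insert_left, Finset.mem_insert, Finset.mem_singleton,
          Finset.disjoint_singleton_left, Fin.ext_iff, Fin.val_zero, Fin.val_one]
        omega
      · simp [Fin.ext_iff]
      · simp
    rw [mul_assoc, this, ← mul_assoc (swap _ _) (swap _ _) (swap _ _), swap_mul_self, one_mul, swap_mul_self]

theorem exists_theta {M : Type*} [Monoid M] (k : ℕ) (r t : M) (h : MRel k r t) :
    ∃ θ : Perm (Fin (k+3)) →* M, θ (finRotate (k+3))⁻¹ = r ∧ θ (swap 0 1) = t := by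
  let ru : Mˣ := ⟨r, r ^ (k+2), by rw [← pow_succ', h.h2], by rw [← pow_succ, h.h2]⟩
  let tu : Mˣ := ⟨t, t, h.h1, h.h1⟩
  have hu : MRel k ru tu := by
    refine ⟨?_, ?_, ?_, ?_, ?_⟩
    · ext; exact h.h1
    · ext; simpa using h.h2
    · ext; simpa using h.h3
    · ext; simpa using h.h4
    · intro j hj hj2; ext; simpa using h.h5 j hj hj2
  have hp := perm_rel k
  let R : Perm (Fin (k+3)) × Mˣ := ((finRotate (k+3))⁻¹, ru)
  let T : Perm (Fin (k+3)) × Mˣ := (swap 0 1, tu)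
  let K := Subgroup.closure {R, T}
  let F : K →* Perm (Fin (k+3)) := (MonoidHom.fst _ _).comp K.subtype
  have hR : R ∈ K := Subgroup.subset_closure (by simp)
  have hT : T ∈ K := Subgroup.subset_closure (by simp)
  have inj : Function.Injective F := by
    rw [injective_iff_map_eq_one]
    rintro ⟨x, hx⟩ hFx
    have := moore_inj (k := k) R T (Prod.ext hp.h1 hu.h1) (Prod.ext hp.h2 hu.h2) (Prod.ext hp.h3 hu.h3)
      (Prod.ext hp.h4 hu.h4) (fun j hj hj2 => Prod.ext (hp.h5 j hj hj2) (hu.h5 j hj hj2))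
      (MonoidHom.fst _ _) rfl rfl x hx hFx
    exact Subtype.ext this
  have surj : Function.Surjective F := by
    rw [← MonoidHom.range_eq_top, eq_top_iff, ← perm_gen k, Subgroup.closure_le]
    rintro x (rfl | rfl)
    · exact ⟨⟨R, hR⟩, rfl⟩
    · exact ⟨⟨T, hT⟩, rfl⟩
  let e := MulEquiv.ofBijective F ⟨inj, surj⟩
  refine ⟨(Units.coeHom M).comp ((MonoidHom.snd _ _).comp (K.subtype.comp e.symm.toMonoidHom)), ?_, ?_⟩
  · have : e.symm (finRotate (k+3))⁻¹ = ⟨R, hR⟩ := by rw [MulEquiv.symm_apply_eq]; rfl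
    change (((e.symm (finRotate (k+3))⁻¹ : K) : Perm (Fin (k+3)) × Mˣ).2 : M) = r
    rw [this]
  · have : e.symm (swap 0 1) = ⟨T, hT⟩ := by rw [MulEquiv.symm_apply_eq]; rfl
    change (((e.symm (swap 0 1) : K) : Perm (Fin (k+3)) × Mˣ).2 : M) = t
    rw [this]
end Cox

section DatSec

/-- A permutation fixing everything outside `S` lies in any subgroup containing the swaps in `S`. -/
theorem mem_of_swaps {α : Type*} [Fintype α] [DecidableEq α] (K : Subgroup (Perm α)) (S : Finset α)
    (hK : ∀ i ∈ S, ∀ j ∈ S, i ≠ j → swap i j ∈ K) (g : Perm α) (hg : ∀ x, x ∉ S → g x = x) : g ∈ K := by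
  have key : ∀ f : Perm {x // x ∈ S}, Perm.ofSubtype f ∈ K := by
    intro f
    induction f using Equiv.Perm.swap_induction_on with
    | one => simp
    | swap_mul f x y hxy ih =>
      rw [map_mul, Perm.ofSubtype_swap_eq]
      exact mul_mem (hK _ x.2 _ y.2 (fun h => hxy (Subtype.ext h))) ih
  have h1 : ∀ x, g x ∈ S ↔ x ∈ S := by
    intro x
    constructor
    · intro h
      by_contra hx
      rw [hg x hx] at h
      exact hx h
    · intro h
      by_contra hx
      have := hg _ hx
      have := g.injective this
      rw [this] at hx
      exact hx h
  have := key (g.subtypePerm h1)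
  rwa [Perm.ofSubtype_subtypePerm] at this
  intro x hx
  by_contra h
  exact hx (hg x h)

/-- The data carried by a monoid satisfying the relations. -/
structure Dat (k : ℕ) (M : Type*) [Monoid M] where
  θ : Perm (Fin (k+3)) →* M
  b : M
  z : M
  c : M
  hbb : b * b = b
  hzz : z * z = z
  hbt : θ (swap 0 1) * b = b * θ (swap 0 1)
  hzθ : ∀ g, z * θ g = θ g * z
  hzb : z * b = b * z
  r12 : θ (swap (Fin.last (k+2)) 0) * b * θ (swap (Fin.last (k+2)) 0) =
    θ (finRotate (k+3)) * b * θ (finRotate (k+3))⁻¹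
  r13 : (θ (finRotate (k+3)) * b * θ (finRotate (k+3))⁻¹) * θ (swap 0 1) *
      (θ (finRotate (k+3)) * b * θ (finRotate (k+3))⁻¹) * θ (swap 0 1) =
    θ (swap 0 1) * (θ (finRotate (k+3)) * b * θ (finRotate (k+3))⁻¹) * θ (swap 0 1) *
      (θ (finRotate (k+3)) * b * θ (finRotate (k+3))⁻¹)
  r14 : (θ (finRotate (k+3)) * b * θ (finRotate (k+3))⁻¹) * θ (swap 0 1) *
      (θ (finRotate (k+3)) * b * θ (finRotate (k+3))⁻¹) =
    θ (swap 0 1) * (θ (finRotate (k+3)) * b * θ (finRotate (k+3))⁻¹) * θ (swap 0 1) *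
      (θ (finRotate (k+3)) * b * θ (finRotate (k+3))⁻¹)
  hccc : c * c * c = c
  hbac : b * θ (finRotate (k+3))⁻¹ * c = c * z
  hbap : (b * θ (finRotate (k+3))⁻¹) ^ (k+1) * b = c * c * θ (swap 0 1) * θ (finRotate (k+3))⁻¹ ^ k
  hzcc : z * (c * c) = c * θ (swap 0 1) * c
  hzcz : z * c * z * c = z * c * z

namespace Dat
variable {k : ℕ} {M : Type*} [Monoid M] (D : Dat k M)

theorem θ_cancel (g : Perm (Fin (k+3))) (x : M) : D.θ g⁻¹ * (D.θ g * x) = x := by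
  rw [← mul_assoc, ← map_mul]; simp

theorem θ_cancel' (g : Perm (Fin (k+3))) (x : M) : D.θ g * (D.θ g⁻¹ * x) = x := by
  rw [← mul_assoc, ← map_mul]; simp

/-- permutations commuting with an element -/
def cent (x : M) : Subgroup (Perm (Fin (k+3))) where
  carrier := {g | D.θ g * x = x * D.θ g}
  one_mem' := by simp
  mul_mem' := by
    intro g h hg hh
    simp only [Set.mem_ofPred_eq, map_mul] at *
    rw [mul_assoc, hh, ← mul_assoc, hg, mul_assoc]
  inv_mem' := by
    intro g hg
    simp only [Set.mem_ofPred_eq] at *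
    have : D.θ g⁻¹ * (D.θ g * x) * D.θ g⁻¹ = D.θ g⁻¹ * (x * D.θ g) * D.θ g⁻¹ := by rw [hg]
    rw [θ_cancel, mul_assoc, mul_assoc x, ← map_mul, mul_inv_cancel, map_one, mul_one] at this
    exact this.symm

/-- permutations right-absorbed by an element -/
def absb (x : M) : Subgroup (Perm (Fin (k+3))) where
  carrier := {g | x * D.θ g = x}
  one_mem' := by simp
  mul_mem' := by
    intro g h hg hh
    simp only [Set.mem_ofPred_eq, map_mul] at *
    rw [← mul_assoc, hg, hh]
  inv_mem' := by
    intro g hg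
    simp only [Set.mem_ofPred_eq] at *
    nth_rewrite 1 [← hg]
    rw [mul_assoc, ← map_mul, mul_inv_cancel, map_one, mul_one]

theorem mem_cent {x : M} {g} : g ∈ D.cent x ↔ D.θ g * x = x * D.θ g := Iff.rfl
theorem mem_absb {x : M} {g} : g ∈ D.absb x ↔ x * D.θ g = x := Iff.rfl

theorem cyc_mem : swap (Fin.last (k+2)) 0 * finRotate (k+3) ∈ D.cent D.b := by
  rw [mem_cent]
  have h := D.r12
  have h2 : D.θ (swap (Fin.last (k+2)) 0) * (D.θ (swap (Fin.last (k+2)) 0) * D.b *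
    D.θ (swap (Fin.last (k+2)) 0)) * D.θ (finRotate (k+3)) =
    D.θ (swap (Fin.last (k+2)) 0) * (D.θ (finRotate (k+3)) * D.b * D.θ (finRotate (k+3))⁻¹) *
      D.θ (finRotate (k+3)) := by rw [h]
  simp only [mul_assoc] at h2
  rw [← map_mul D.θ (finRotate (k+3))⁻¹, inv_mul_cancel, map_one, mul_one, ← mul_assoc (D.θ (swap _ _)), ← map_mul,
    swap_mul_self, map_one, one_mul] at h2
  rw [map_mul, mul_assoc, ← h2]

theorem swap_adj_mem (i : ℕ) (hi : i + 1 < k + 2) :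
    swap (⟨i, by omega⟩ : Fin (k+3)) ⟨i+1, by omega⟩ ∈ D.cent D.b := by
  induction i with
  | zero => exact D.hbt
  | succ i ih =>
    have h := mul_mem (mul_mem D.cyc_mem (ih (by omega))) (inv_mem D.cyc_mem)
    rw [← Equiv.swap_apply_apply, Perm.mul_apply, Perm.mul_apply, rot_lt k i (by omega),
      rot_lt k (i+1) (by omega), swap_apply_of_ne_of_ne, swap_apply_of_ne_of_ne] at h
    · exact h
    all_goals simp [Fin.ext_iff]
    all_goals omega

theorem swap_zero_mem (i : ℕ) (hi : i + 1 < k + 2) :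
    swap (0 : Fin (k+3)) ⟨i+1, by omega⟩ ∈ D.cent D.b := by
  induction i with
  | zero => exact D.hbt
  | succ i ih =>
    have h := mul_mem (mul_mem (D.swap_adj_mem (i+1) hi) (ih (by omega)))
      (inv_mem (D.swap_adj_mem (i+1) hi))
    rw [← Equiv.swap_apply_apply, swap_apply_left, swap_apply_of_ne_of_ne] at h
    · exact h
    all_goals simp [Fin.ext_iff]

theorem stab_mem (g : Perm (Fin (k+3))) (hg : g (Fin.last (k+2)) = Fin.last (k+2)) :
    g ∈ D.cent D.b := by
  have h0 : ∀ i : Fin (k+3), i ≠ Fin.last (k+2) → swap 0 i ∈ D.cent D.b := by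
    rintro ⟨i, hi⟩ h
    have : i ≠ k + 2 := fun h' => h (Fin.ext h')
    cases i with
    | zero =>
      have : swap (0 : Fin (k+3)) ⟨0, hi⟩ = 1 := swap_self _
      rw [this]; exact one_mem _
    | succ i => exact D.swap_zero_mem i (by omega)
  refine mem_of_swaps _ (Finset.univ.erase (Fin.last (k+2))) ?_ g ?_
  · intro i hi j hj hij
    have hi := h0 i (Finset.ne_of_mem_erase hi)
    have hj := h0 j (Finset.ne_of_mem_erase hj)
    by_cases hj0 : j = 0
    · rw [swap_comm, hj0]; exact hi
    · have h := mul_mem (mul_mem hi hj) (inv_mem hi)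
      rw [← Equiv.swap_apply_apply, swap_apply_left, swap_apply_of_ne_of_ne hj0 hij.symm] at h
      exact h
  · intro x hx
    have : x = Fin.last (k+2) := by simpa using hx
    rw [this, hg]

/-- idempotent missing the leaf `i` -/
def e (i : Fin (k+3)) : M := D.θ (swap i (Fin.last (k+2))) * D.b * D.θ (swap i (Fin.last (k+2)))⁻¹

theorem e_eq (g : Perm (Fin (k+3))) : D.θ g * D.b * D.θ g⁻¹ = D.e (g (Fin.last (k+2))) := by
  have h : (swap (g (Fin.last (k+2))) (Fin.last (k+2)))⁻¹ * g ∈ D.cent D.b := by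
    apply D.stab_mem
    simp
  rw [mem_cent] at h
  unfold e
  set s := swap (g (Fin.last (k+2))) (Fin.last (k+2))
  have h2 : D.θ s * (D.θ (s⁻¹ * g) * D.b) * D.θ g⁻¹ = D.θ s * (D.b * D.θ (s⁻¹ * g)) * D.θ g⁻¹ := by rw [h]
  simp only [map_mul, mul_assoc] at h2
  rw [θ_cancel', ← map_mul D.θ g, mul_inv_cancel, map_one, mul_one] at h2
  simp only [mul_assoc]
  exact h2

theorem e_last : D.e (Fin.last (k+2)) = D.b := by
  have := D.e_eq 1
  simpa using this.symm

theorem e_conj (g : Perm (Fin (k+3))) (i) : D.θ g * D.e i = D.e (g i) * D.θ g := by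
  have h := D.e_eq (g * swap i (Fin.last (k+2)))
  rw [Perm.mul_apply, swap_apply_right] at h
  rw [← h, e]
  simp only [mul_inv_rev, map_mul, mul_assoc]
  rw [← map_mul D.θ g⁻¹, inv_mul_cancel, map_one, mul_one]

theorem e_conj' (g : Perm (Fin (k+3))) (i) : D.θ g * D.e i * D.θ g⁻¹ = D.e (g i) := by
  rw [e_conj, mul_assoc, ← map_mul, mul_inv_cancel, map_one, mul_one]

theorem e_zero : D.θ (finRotate (k+3)) * D.b * D.θ (finRotate (k+3))⁻¹ = D.e 0 := by
  rw [e_eq, finRotate_last]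

theorem e_idem (i) : D.e i * D.e i = D.e i := by
  simp only [e, mul_assoc]
  rw [θ_cancel, ← mul_assoc D.b, D.hbb]

theorem z_e (i) : D.z * D.e i = D.e i * D.z := by
  simp only [e, mul_assoc]
  rw [← D.hzθ (swap i _)⁻¹, ← mul_assoc D.z, D.hzθ, mul_assoc, ← mul_assoc D.z D.b, D.hzb, mul_assoc]

theorem exists_perm_two {α : Type*} [DecidableEq α] (a b i j : α) (hab : a ≠ b) (hij : i ≠ j) :
    ∃ g : Perm α, g a = i ∧ g b = j := by
  refine ⟨swap (swap a i b) j * swap a i, ?_, ?_⟩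
  · rw [Perm.mul_apply, swap_apply_left, swap_apply_of_ne_of_ne _ hij]
    intro h
    have : swap a i a = swap a i b := by rw [swap_apply_left]; exact h
    exact hab ((swap a i).injective this)
  · rw [Perm.mul_apply, swap_apply_left]

theorem e_comm01 : D.e 0 * D.e 1 = D.e 1 * D.e 0 := by
  have h := D.r13
  rw [e_zero] at h
  have h1 : D.e 1 = D.θ (swap 0 1) * D.e 0 * D.θ (swap 0 1) := by
    have := D.e_conj' (swap 0 1) 0
    rw [swap_inv, swap_apply_left] at this
    exact this.symm
  rw [h1]
  simpa only [mul_assoc] using h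

theorem e_abs01 : D.e 0 * D.e 1 * D.θ (swap 0 1) = D.e 0 * D.e 1 := by
  have h := D.r14
  rw [e_zero] at h
  have h1 : D.e 1 = D.θ (swap 0 1) * D.e 0 * D.θ (swap 0 1) := by
    have := D.e_conj' (swap 0 1) 0
    rw [swap_inv, swap_apply_left] at this
    exact this.symm
  have h2 := D.e_conj (swap 0 1) 0
  rw [swap_apply_left] at h2
  rw [mul_assoc, ← h2, ← mul_assoc, h, e_comm01, h1]

theorem e_comm (i j) : D.e i * D.e j = D.e j * D.e i := by
  rcases eq_or_ne i j with rfl | hij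
  · rfl
  obtain ⟨g, rfl, rfl⟩ := exists_perm_two (0 : Fin (k+3)) 1 i j (by simp) hij
  have h : D.θ g * (D.e 0 * D.e 1) * D.θ g⁻¹ = D.θ g * (D.e 1 * D.e 0) * D.θ g⁻¹ := by
    rw [e_comm01]
  rw [← e_conj', ← e_conj']
  simp only [mul_assoc] at h ⊢
  rw [θ_cancel, θ_cancel]
  exact h

theorem e_abs (i j) (hij : i ≠ j) : D.e i * D.e j * D.θ (swap i j) = D.e i * D.e j := by
  obtain ⟨g, rfl, rfl⟩ := exists_perm_two (0 : Fin (k+3)) 1 i j (by simp) hij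
  have h : D.θ g * (D.e 0 * D.e 1 * D.θ (swap 0 1)) * D.θ g⁻¹ = D.θ g * (D.e 0 * D.e 1) * D.θ g⁻¹ := by
    rw [e_abs01]
  rw [← e_conj', ← e_conj', Equiv.swap_apply_apply, map_mul, map_mul]
  simp only [mul_assoc] at h ⊢
  rw [θ_cancel, θ_cancel, θ_cancel]
  exact h

theorem e_pw (S : Set (Fin (k+3))) : S.Pairwise (Function.onFun Commute D.e) :=
  fun i _ j _ _ => D.e_comm i j

/-- idempotent missing the leaves in `S` -/
def E (S : Finset (Fin (k+3))) : M := S.noncommProd D.e (D.e_pw _)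

theorem E_empty : D.E ∅ = 1 := by simp [E]

theorem E_insert' (i) (S) (h : i ∉ S) : D.E (insert i S) = D.e i * D.E S := by
  rw [E, Finset.noncommProd_insert_of_notMem _ _ _ _ h, E]

theorem e_E_comm (i) (S) : D.e i * D.E S = D.E S * D.e i := by
  induction S using Finset.induction_on with
  | empty => simp [E_empty]
  | insert j S h ih => rw [E_insert' _ _ _ h, ← mul_assoc, e_comm, mul_assoc, ih, mul_assoc]

theorem e_E_of_mem (i) (S) (h : i ∈ S) : D.e i * D.E S = D.E S := by
  have : insert i (S.erase i) = S := Finset.insert_erase h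
  rw [← this, E_insert' _ _ _ (Finset.notMem_erase i S), ← mul_assoc, e_idem]

theorem E_insert (i) (S) : D.E (insert i S) = D.e i * D.E S := by
  by_cases h : i ∈ S
  · rw [e_E_of_mem _ _ _ h, Finset.insert_eq_of_mem h]
  · exact D.E_insert' i S h

theorem E_union (S T) : D.E S * D.E T = D.E (S ∪ T) := by
  induction S using Finset.induction_on with
  | empty => simp [E_empty]
  | insert j S h ih => rw [E_insert, mul_assoc, ih, Finset.insert_union, E_insert]

theorem E_single (i) : D.E {i} = D.e i := by simp [E]

theorem z_E (S) : D.z * D.E S = D.E S * D.z := by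
  induction S using Finset.induction_on with
  | empty => simp [E_empty]
  | insert j S h ih => rw [E_insert, ← mul_assoc, z_e, mul_assoc, ih, mul_assoc]

theorem θ_E (g : Perm (Fin (k+3))) (S) : D.θ g * D.E S = D.E (S.image g) * D.θ g := by
  induction S using Finset.induction_on with
  | empty => simp [E_empty]
  | insert j S h ih =>
    rw [E_insert, ← mul_assoc, e_conj, mul_assoc, ih, Finset.image_insert, E_insert, mul_assoc]

theorem E_abs (S) (g : Perm (Fin (k+3))) (hg : ∀ x, x ∉ S → g x = x) : D.E S * D.θ g = D.E S := by
  have : g ∈ D.absb (D.E S) := by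
    refine mem_of_swaps _ S ?_ g hg
    intro i hi j hj hij
    rw [mem_absb]
    have : D.E S = D.E S * (D.e i * D.e j) := by
      rw [← mul_assoc, ← e_E_comm, e_E_of_mem _ _ _ hi, ← e_E_comm, e_E_of_mem _ _ _ hj]
    rw [this, mul_assoc (D.E S), e_abs _ _ _ hij]
  exact this

theorem θ_abs (S) (g : Perm (Fin (k+3))) (hg : ∀ x, x ∉ S → g x = x) : D.θ g * D.E S = D.E S := by
  rw [θ_E]
  have : S.image g = S := by
    apply Finset.eq_of_subset_of_card_le
    · intro y hy
      obtain ⟨x, hx, rfl⟩ := Finset.mem_image.1 hy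
      by_contra h
      have := g.injective (hg _ h)
      rw [this] at h
      exact h hx
    · rw [Finset.card_image_of_injective _ g.injective]
  rw [this, E_abs _ _ _ hg]

/-- partial identity on the first leaf (and the centre) -/
def F : M := D.E {0}ᶜ
/-- partial identity on the centre -/
def Z : M := D.E Finset.univ

theorem ba_pow (j : ℕ) (hj : j ≤ k + 2) : (D.b * D.θ (finRotate (k+3))⁻¹) ^ j * D.b =
    D.E (Finset.univ.filter (fun i => k + 2 ≤ i.val + j)) * D.θ (finRotate (k+3))⁻¹ ^ j := by
  induction j with
  | zero =>
    rw [pow_zero, pow_zero, one_mul, mul_one, ← e_last, ← E_single]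
    congr 1
    ext i
    simp [Fin.ext_iff]
    omega
  | succ j ih =>
    rw [pow_succ', mul_assoc, ih (by omega), mul_assoc, ← mul_assoc (D.θ _), θ_E, pow_succ', ← mul_assoc, ← mul_assoc, 
      ← e_last, ← E_insert, mul_assoc]
    congr 2
    ext i
    simp only [Finset.mem_insert, Finset.mem_image, Finset.mem_filter, Finset.mem_univ, true_and]
    constructor
    · rintro (rfl | ⟨a, ha, rfl⟩)
      · simp
      · obtain ⟨i, rfl⟩ := (finRotate (k+3)).surjective a
        have h1 : (finRotate (k+3))⁻¹ (finRotate (k+3) i) = i := by simp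
        rw [h1]
        by_cases h : (i : ℕ) = k + 2
        · omega
        · have h2 := rot_lt k i (by omega)
          have h3 : finRotate (k+3) i = ⟨i + 1, by omega⟩ := h2
          rw [h3] at ha
          simp at ha
          omega
    · intro h
      by_cases h' : i = Fin.last (k+2)
      · left; exact h'
      · right
        have : (i : ℕ) ≠ k + 2 := fun h2 => h' (Fin.ext h2)
        refine ⟨finRotate (k+3) i, ?_, by simp⟩
        have := rot_lt k i (by omega)
        rw [this]
        simp; omega

theorem cc : D.c * D.c = D.F := by
  have h := D.hbap
  rw [ba_pow _ _ (by omega)] at h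
  have h2 : (Finset.univ.filter (fun i : Fin (k+3) => k + 2 ≤ i.val + (k+1))) = {0}ᶜ := by
    ext i
    simp only [Finset.mem_filter, Finset.mem_univ, true_and, Finset.mem_compl,
      Finset.mem_singleton, Fin.ext_iff, Fin.val_zero]
    omega
  rw [h2] at h
  change D.F * _ = _ at h
  rw [pow_succ', ← mul_assoc] at h
  have h3 := congrArg (fun x => x * (D.θ (finRotate (k+3)) ^ k) * D.θ (swap 0 1)) h
  simp only [← map_pow] at h3
  simp only [mul_assoc, ← map_mul] at h3
  simp only [inv_pow, inv_mul_cancel_left, swap_mul_self, map_one, mul_one] at h3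
  rw [← h3, F, E_abs]
  intro x hx
  have : x = 0 := by simpa using hx
  rw [this, Perm.mul_apply, swap_apply_left, Perm.inv_eq_iff_eq]
  exact (rot_lt k 0 (by omega)).symm

theorem cF : D.c * D.F = D.c := by rw [← cc, ← mul_assoc, D.hccc]
theorem Fc : D.F * D.c = D.c := by rw [← cc, D.hccc]

theorem e_Z (i) : D.e i * D.Z = D.Z := D.e_E_of_mem _ _ (by simp)
theorem Z_θ (g) : D.Z * D.θ g = D.Z := D.E_abs _ _ (by simp)
theorem θ_Z (g) : D.θ g * D.Z = D.Z := D.θ_abs _ _ (by simp)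
theorem e0_F : D.e 0 * D.F = D.Z := by
  rw [F, ← E_insert, Z]
  congr 1
  ext i; simp
theorem ZF : D.Z * D.F = D.Z := by rw [Z, F, E_union]; congr 1; ext; simp
theorem FZ : D.F * D.Z = D.Z := by rw [Z, F, E_union]; congr 1; ext; simp
theorem ZZ : D.Z * D.Z = D.Z := by rw [Z, E_union]; simp
theorem FF : D.F * D.F = D.F := by rw [F, E_union]; simp
theorem e_F (i) (h : i ≠ 0) : D.e i * D.F = D.F := D.e_E_of_mem _ _ (by simpa using h)
theorem z_Z : D.z * D.Z = D.Z * D.z := D.z_E _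
theorem z_F : D.z * D.F = D.F * D.z := D.z_E _

theorem e0_c : D.e 0 * D.c = D.Z * D.c := by
  rw [← Fc, ← mul_assoc, e0_F, ← mul_assoc, ZF]

theorem c_z : D.c * D.z = D.Z * D.c := by
  rw [← D.hbac]
  have h := D.e_conj (finRotate (k+3))⁻¹ 0
  have h0 : (finRotate (k+3))⁻¹ 0 = Fin.last (k+2) := by
    rw [Perm.inv_eq_iff_eq, finRotate_last]
  rw [h0, e_last] at h
  rw [← h, mul_assoc, e0_c, ← mul_assoc, θ_Z]

theorem c_e0 : D.c * D.e 0 = D.z * D.c := by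
  have h : D.c * (D.e 0 * D.c) * D.c = D.c * (D.c * D.z) * D.c := by rw [e0_c, c_z]
  rw [mul_assoc, mul_assoc, cc, ← mul_assoc D.c D.c, cc, ← z_F, mul_assoc D.z, Fc, F, e_E_comm,
    ← F, ← mul_assoc, cF] at h
  exact h

theorem c_Z : D.c * D.Z = D.z * D.c := by
  rw [← c_e0, ← e0_F, F, e_E_comm, ← F, ← mul_assoc, cF]

theorem c_e (i) (h : i ≠ 0) : D.c * D.e i = D.c := by
  nth_rewrite 1 [← cF]
  rw [mul_assoc, F, ← e_E_comm, ← F, e_F _ _ h, cF]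

theorem zZ_c : D.z * (D.Z * D.c) = D.z * D.Z := by
  have h := D.hzcz
  have h1 : D.z * D.c * D.z = D.z * (D.Z * D.c) := by rw [mul_assoc, c_z]
  rw [h1, mul_assoc, mul_assoc, cc, ZF] at h
  exact h.symm

theorem zc_θ (g) : D.z * D.c * D.θ g = D.z * D.c := by
  rw [← c_Z, mul_assoc, Z_θ]

theorem E_c (T) (h : 0 ∉ T) : D.E T * D.c = D.c := by
  nth_rewrite 1 [← Fc]
  rw [← mul_assoc, F, E_union]
  have : T ∪ {0}ᶜ = {0}ᶜ := by
    apply Finset.union_eq_right.2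
    intro x hx
    simp only [Finset.mem_compl, Finset.mem_singleton]
    rintro rfl
    exact h hx
  rw [this, ← F, Fc]

theorem E_c0 (T) (h : 0 ∈ T) : D.E T * D.c = D.Z * D.c := by
  nth_rewrite 1 [← Fc]
  rw [← mul_assoc, F, E_union]
  have : T ∪ {0}ᶜ = Finset.univ := by
    ext x
    by_cases hx : x = 0
    · simp [hx, h]
    · simp [hx]
  rw [this, Z]

theorem θ_c (g : Perm (Fin (k+3))) (h : g 0 = 0) : D.θ g * D.c = D.c := by
  rw [← Fc, ← mul_assoc, F, θ_abs]
  intro x hx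
  have : x = 0 := by simpa using hx
  rw [this, h]

theorem c_θ (g : Perm (Fin (k+3))) (h : g 0 = 0) : D.c * D.θ g = D.c := by
  rw [← cF, mul_assoc, F, E_abs]
  intro x hx
  have : x = 0 := by simpa using hx
  rw [this, h]

theorem θ_c_eq (g h : Perm (Fin (k+3))) (hgh : g 0 = h 0) : D.θ g * D.c = D.θ h * D.c := by
  have : g = h * (h⁻¹ * g) := by simp
  rw [this, map_mul, mul_assoc, θ_c]
  rw [Perm.mul_apply, hgh]; simp

theorem c_θ_eq (g h : Perm (Fin (k+3))) (hgh : g⁻¹ 0 = h⁻¹ 0) : D.c * D.θ g = D.c * D.θ h := by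
  have : g = (g * h⁻¹) * h := by simp
  rw [this, map_mul, ← mul_assoc, c_θ]
  rw [Perm.mul_apply, ← hgh]; simp

theorem c_θ_c (g : Perm (Fin (k+3))) (h : g 0 ≠ 0) : D.c * D.θ g * D.c = D.z * D.F := by
  rw [← cc, D.hzcc]
  obtain ⟨p, hp0, hp1⟩ := exists_perm_two (0 : Fin (k+3)) 1 0 (g 0) (by simp) h.symm
  rw [mul_assoc, D.θ_c_eq g (p * swap 0 1) (by simp [hp1]), map_mul, mul_assoc, ← mul_assoc,
    D.c_θ p hp0, mul_assoc]

/-- normal forms -/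
inductive NF : M → Prop
  | t1 (S g) : NF (D.E S * D.θ g)
  | t2 (S g) : NF (D.z * (D.E S * D.θ g))
  | t3 (g h) : NF (D.θ g * D.c * D.θ h)
  | t4 (h) : NF (D.Z * D.c * D.θ h)
  | t5 (g) : NF (D.θ g * (D.z * D.c))

theorem NF_congr {x y : M} (h : D.NF x) (e : y = x) : D.NF y := e ▸ h

theorem NF_one : D.NF 1 := D.NF_congr (NF.t1 ∅ 1) (by simp [E_empty])

theorem z_θE (S g) : D.E S * D.θ g * D.z = D.z * (D.E S * D.θ g) := by
  rw [mul_assoc, ← D.hzθ, ← mul_assoc, ← z_E, mul_assoc]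

theorem NF_θ {x : M} (hx : D.NF x) (h) : D.NF (x * D.θ h) := by
  cases hx with
  | t1 S g => exact D.NF_congr (NF.t1 S (g * h)) (by rw [map_mul, mul_assoc])
  | t2 S g => exact D.NF_congr (NF.t2 S (g * h)) (by rw [map_mul, mul_assoc, mul_assoc])
  | t3 g g' => exact D.NF_congr (NF.t3 g (g' * h)) (by rw [map_mul, ← mul_assoc])
  | t4 g => exact D.NF_congr (NF.t4 (g * h)) (by simp only [map_mul, mul_assoc])
  | t5 g => exact D.NF_congr (NF.t5 g) (by rw [mul_assoc, zc_θ])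

theorem NF_z {x : M} (hx : D.NF x) : D.NF (x * D.z) := by
  cases hx with
  | t1 S g => exact D.NF_congr (NF.t2 S g) (by rw [z_θE])
  | t2 S g => exact D.NF_congr (NF.t2 S g) (by rw [mul_assoc, z_θE, ← mul_assoc, D.hzz])
  | t3 g h => exact D.NF_congr (NF.t4 h) (by
      rw [mul_assoc, ← D.hzθ, ← mul_assoc, mul_assoc _ D.c, c_z, ← mul_assoc, θ_Z])
  | t4 g => exact D.NF_congr (NF.t4 g) (by
      rw [mul_assoc, ← D.hzθ, ← mul_assoc, mul_assoc _ D.c, c_z, ← mul_assoc, ZZ])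
  | t5 g => exact D.NF_congr (NF.t2 Finset.univ 1) (by
      rw [mul_assoc, mul_assoc, c_z, zZ_c, ← mul_assoc, ← D.hzθ, mul_assoc, θ_Z, Z]; simp)

theorem NF_e {x : M} (hx : D.NF x) (i) : D.NF (x * D.e i) := by
  cases hx with
  | t1 S g => exact D.NF_congr (NF.t1 (insert (g i) S) g) (by
      rw [mul_assoc, e_conj, ← mul_assoc, ← e_E_comm, ← E_insert])
  | t2 S g => exact D.NF_congr (NF.t2 (insert (g i) S) g) (by
      rw [mul_assoc, mul_assoc, e_conj, ← mul_assoc (D.E S), ← e_E_comm, ← E_insert])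
  | t3 g h =>
    by_cases hi : h i = 0
    · exact D.NF_congr (NF.t5 g) (by
        rw [mul_assoc, e_conj, hi, ← mul_assoc, mul_assoc _ D.c, c_e0, mul_assoc, zc_θ])
    · exact D.NF_congr (NF.t3 g h) (by
        rw [mul_assoc, e_conj, ← mul_assoc, mul_assoc _ D.c, c_e _ _ hi])
  | t4 h =>
    by_cases hi : h i = 0
    · exact D.NF_congr (NF.t2 Finset.univ 1) (by
        rw [mul_assoc, e_conj, hi, ← mul_assoc, mul_assoc _ D.c, c_e0, ← mul_assoc, ← z_Z, mul_assoc D.z,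
          zZ_c, mul_assoc, Z_θ, Z]; simp)
    · exact D.NF_congr (NF.t4 h) (by
        rw [mul_assoc, e_conj, ← mul_assoc, mul_assoc _ D.c, c_e _ _ hi])
  | t5 g => exact D.NF_congr (NF.t5 g) (by
      rw [← c_Z, mul_assoc, mul_assoc, Z, ← e_E_comm, ← Z, e_Z])

theorem E_θ (S) (g : Perm (Fin (k+3))) : D.E S * D.θ g = D.θ g * D.E (S.image (g⁻¹ : Perm (Fin (k+3)))) := by
  rw [θ_E, Finset.image_image]
  congr 2
  ext x; simp

theorem NF_c {x : M} (hx : D.NF x) : D.NF (x * D.c) := by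
  have h1 : ∀ S g, D.E S * D.θ g * D.c = D.θ g * D.c ∨ D.E S * D.θ g * D.c = D.Z * D.c := by
    intro S g
    rw [E_θ]
    by_cases h : 0 ∈ S.image (g⁻¹ : Perm (Fin (k+3)))
    · right; rw [mul_assoc, E_c0 _ _ h, ← mul_assoc, θ_Z]
    · left; rw [mul_assoc, E_c _ _ h]
  cases hx with
  | t1 S g =>
    rcases h1 S g with h | h
    · exact D.NF_congr (NF.t3 g 1) (by rw [h]; simp)
    · exact D.NF_congr (NF.t4 1) (by rw [h]; simp)
  | t2 S g =>
    rcases h1 S g with h | h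
    · exact D.NF_congr (NF.t5 g) (by rw [mul_assoc, h, ← mul_assoc, D.hzθ, mul_assoc])
    · exact D.NF_congr (NF.t2 Finset.univ 1) (by rw [mul_assoc, h, zZ_c, Z]; simp)
  | t3 g h =>
    by_cases h0 : h 0 = 0
    · exact D.NF_congr (NF.t1 _ g) (by
        rw [mul_assoc, D.θ_c _ h0, mul_assoc, cc, F, θ_E])
    · exact D.NF_congr (NF.t2 _ g) (by
        rw [mul_assoc, mul_assoc, ← mul_assoc D.c, D.c_θ_c _ h0, ← mul_assoc, ← D.hzθ, mul_assoc, F, θ_E])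
  | t4 h =>
    by_cases h0 : h 0 = 0
    · exact D.NF_congr (NF.t1 Finset.univ 1) (by
        rw [mul_assoc, D.θ_c _ h0, mul_assoc, cc, ZF, Z]; simp)
    · exact D.NF_congr (NF.t2 Finset.univ 1) (by
        rw [mul_assoc, mul_assoc, ← mul_assoc D.c, D.c_θ_c _ h0, ← mul_assoc, ← z_Z, mul_assoc, ZF, Z]; simp)
  | t5 g => exact D.NF_congr (NF.t2 _ g) (by
      rw [mul_assoc, mul_assoc, cc, ← mul_assoc, ← D.hzθ, mul_assoc, F, θ_E])

theorem NF_b {x : M} (hx : D.NF x) : D.NF (x * D.b) := by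
  rw [← e_last]; exact D.NF_e hx _

end Dat
end DatSec

section Conc
variable {k : ℕ}

/-- partial maps -/
abbrev PP (k : ℕ) := Fin (k+4) →. Fin (k+4)

theorem mem_pmul {V : Type*} (p q : V →. V) (x y : V) : y ∈ (p * q) x ↔ ∃ w ∈ p x, y ∈ q w := by
  change y ∈ (q.comp p) x ↔ _
  exact Part.mem_bind_iff

theorem mem_pone {V : Type*} (x y : V) : y ∈ (1 : V →. V) x ↔ y = x := by
  change y ∈ (PFun.id V) x ↔ _
  simp [PFun.id]

/-- action of leaf permutations -/
def Th (g : Perm (Fin (k+3))) : Fin (k+4) →. Fin (k+4) :=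
  fun x => Part.some (Fin.cases (motive := fun _ => Fin (k+4)) 0 (fun i => (g⁻¹ i).succ) x)

/-- partial identities -/
def Ds (S : Finset (Fin (k+3))) : Fin (k+4) →. Fin (k+4) :=
  fun x => ⟨∀ i ∈ S, x ≠ i.succ, fun _ => x⟩

theorem mem_Th_zero (g : Perm (Fin (k+3))) (y) : y ∈ Th g 0 ↔ y = 0 := by simp [Th]
theorem mem_Th_succ (g : Perm (Fin (k+3))) (i y) : y ∈ Th g (Fin.succ i) ↔ y = (g⁻¹ i).succ := by simp [Th]
theorem mem_Ds_zero (S : Finset (Fin (k+3))) (y) : y ∈ Ds S 0 ↔ y = 0 := by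
  constructor
  · rintro ⟨h, rfl⟩; rfl
  · rintro rfl; exact ⟨fun i _ h => (Fin.succ_ne_zero i h.symm), rfl⟩
theorem mem_Ds_succ (S : Finset (Fin (k+3))) (i y) : y ∈ Ds S (Fin.succ i) ↔ i ∉ S ∧ y = i.succ := by
  constructor
  · rintro ⟨h, rfl⟩
    exact ⟨fun hi => h i hi rfl, rfl⟩
  · rintro ⟨h, rfl⟩
    exact ⟨fun j hj h' => h (Fin.succ_injective _ h' ▸ hj), rfl⟩
theorem mem_b2_zero (y) : y ∈ betaTwo (k+4) 0 ↔ False := by simp [betaTwo]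
theorem mem_b2_succ (i : Fin (k+3)) (y) : y ∈ betaTwo (k+4) i.succ ↔ y = i.succ := by simp [betaTwo]
theorem mem_c_zero (h) (y) : y ∈ gammaMap (k+4) h 0 ↔ y = Fin.succ 0 := by
  simp [gammaMap]
theorem mem_c_succ (h) (i : Fin (k+3)) (y) : y ∈ gammaMap (k+4) h i.succ ↔ i = 0 ∧ y = 0 := by
  simp only [gammaMap, Fin.val_succ, Nat.add_eq_zero_iff, one_ne_zero, and_false, if_false]
  by_cases hi : i = 0
  · subst hi; simp
  · have : (i : ℕ) + 1 ≠ 1 := fun h' => hi (Fin.ext (by simpa using h'))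
    simp [this, hi]

theorem pext {p q : Fin (k+4) →. Fin (k+4)} (h0 : ∀ y, y ∈ p 0 ↔ y ∈ q 0)
    (h1 : ∀ (i : Fin (k+3)) y, y ∈ p i.succ ↔ y ∈ q i.succ) : p = q := by
  apply PFun.ext
  intro x y
  induction x using Fin.cases with
  | zero => exact h0 y
  | succ i => exact h1 i y

theorem Th_mul (g h : Perm (Fin (k+3))) : Th (g * h) = Th g * Th h := by
  apply pext
  · simp [mem_pmul, mem_Th_zero]
  · simp [mem_pmul, mem_Th_succ]

/-- `Th` as a homomorphism -/
def ThH : Perm (Fin (k+3)) →* (Fin (k+4) →. Fin (k+4)) where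
  toFun := Th
  map_one' := by
    apply pext
    · simp [mem_pone, mem_Th_zero]
    · simp [mem_pone, mem_Th_succ]
  map_mul' := Th_mul

theorem ThH_apply (g : Perm (Fin (k+3))) : ThH g = Th g := rfl

theorem Ds_mul (S T : Finset (Fin (k+3))) : Ds S * Ds T = Ds (S ∪ T) := by
  apply pext
  · simp [mem_pmul, mem_Ds_zero]
  · intro i y
    simp only [mem_pmul, mem_Ds_succ, Finset.mem_union, not_or]
    constructor
    · rintro ⟨w, ⟨h1, rfl⟩, h2⟩
      rw [mem_Ds_succ] at h2
      exact ⟨⟨h1, h2.1⟩, h2.2⟩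
    · rintro ⟨⟨h1, h2⟩, h3⟩
      exact ⟨_, ⟨h1, rfl⟩, (mem_Ds_succ _ _ _).2 ⟨h2, h3⟩⟩

theorem Ds_empty : Ds (∅ : Finset (Fin (k+3))) = 1 := by
  apply pext
  · simp [mem_pone, mem_Ds_zero]
  · simp [mem_pone, mem_Ds_succ]

theorem Th_Ds (g : Perm (Fin (k+3))) (S) : Th g * Ds S = Ds (S.image g) * Th g := by
  apply pext
  · simp [mem_pmul, mem_Ds_zero, mem_Th_zero]
  · intro i y
    have : g⁻¹ i ∈ S ↔ i ∈ S.image g := by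
      rw [Finset.mem_image]
      constructor
      · intro h; exact ⟨_, h, by simp⟩
      · rintro ⟨a, h, rfl⟩; simpa using h
    simp only [mem_pmul, mem_Ds_succ, mem_Th_succ, exists_eq_left, this, and_assoc, exists_and_left]

theorem Ds_Th_congr (S) (g h : Perm (Fin (k+3))) (hgh : ∀ i, i ∉ S → g⁻¹ i = h⁻¹ i) :
    Ds S * Th g = Ds S * Th h := by
  apply pext
  · simp [mem_pmul, mem_Ds_zero, mem_Th_zero]
  · intro i y
    simp only [mem_pmul, mem_Ds_succ]
    constructor
    · rintro ⟨w, ⟨h1, rfl⟩, h2⟩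
      rw [mem_Th_succ] at h2
      exact ⟨_, ⟨h1, rfl⟩, (mem_Th_succ _ _ _).2 (by rw [← hgh i h1]; exact h2)⟩
    · rintro ⟨w, ⟨h1, rfl⟩, h2⟩
      rw [mem_Th_succ] at h2
      exact ⟨_, ⟨h1, rfl⟩, (mem_Th_succ _ _ _).2 (by rw [hgh i h1]; exact h2)⟩

theorem alphaOne_eq (h) : alphaOne (k+4) h = Th (finRotate (k+3))⁻¹ := by
  apply pext
  · intro y; rw [mem_Th_zero]; simp [alphaOne]
  · intro i y
    rw [mem_Th_succ, inv_inv]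
    simp only [alphaOne, Part.mem_some_iff, Fin.val_succ]
    by_cases hi : (i : ℕ) = k + 2
    · have : i = Fin.last (k+2) := Fin.ext hi
      subst this
      rw [finRotate_last]
      simp
    · have h2 : finRotate (k+3) i = ⟨i + 1, by omega⟩ := rot_lt k i (by omega)
      rw [h2, if_neg (by omega), dif_neg (by omega)]
      rfl

theorem alphaTwo_eq (h) : alphaTwo (k+4) h = Th (swap 0 1) := by
  apply pext
  · intro y; rw [mem_Th_zero]; simp [alphaTwo]
  · intro i y
    rw [mem_Th_succ, swap_inv]
    simp only [alphaTwo, Part.mem_some_iff, Fin.val_succ]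
    by_cases h0 : i = 0
    · subst h0; simp; rfl
    by_cases h1 : i = 1
    · subst h1; simp
    have h0' : (i : ℕ) ≠ 0 := fun h' => h0 (Fin.ext h')
    have h1' : (i : ℕ) ≠ 1 := fun h' => h1 (Fin.ext h')
    rw [swap_apply_of_ne_of_ne h0 h1, if_neg (by omega), if_neg (by omega)]

theorem betaOne_eq : betaOne (k+4) = Ds {Fin.last (k+2)} := by
  apply pext
  · intro y; rw [mem_Ds_zero]; simp [betaOne]
  · intro i y
    rw [mem_Ds_succ]
    simp only [betaOne, Fin.val_succ, Finset.mem_singleton, Fin.ext_iff, Fin.val_last]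
    by_cases hi : (i : ℕ) = k + 2
    · rw [if_neg (by omega)]; simp [hi]
    · rw [if_pos (by omega)]; simp [hi, Fin.ext_iff]

theorem b2_Th (g : Perm (Fin (k+3))) : betaTwo (k+4) * Th g = Th g * betaTwo (k+4) := by
  apply pext
  · simp [mem_pmul, mem_b2_zero, mem_Th_zero]
  · simp [mem_pmul, mem_b2_succ, mem_Th_succ]

theorem b2_Ds (S : Finset (Fin (k+3))) : betaTwo (k+4) * Ds S = Ds S * betaTwo (k+4) := by
  apply pext
  · simp [mem_pmul, mem_b2_zero, mem_Ds_zero]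
  · intro i y
    simp only [mem_pmul, mem_b2_succ, mem_Ds_succ, exists_eq_left]
    constructor
    · rintro ⟨h, rfl⟩; exact ⟨_, ⟨h, rfl⟩, (mem_b2_succ _ _).2 rfl⟩
    · rintro ⟨w, ⟨h, rfl⟩, h2⟩; exact ⟨h, (mem_b2_succ _ _).1 h2⟩

-- membership in the normal forms
theorem n1_zero (S g) (y : Fin (k+4)) : y ∈ (Ds S * Th g : PP k) 0 ↔ y = 0 := by
  simp [mem_pmul, mem_Ds_zero, mem_Th_zero]
theorem n1_succ (S g) (i : Fin (k+3)) (y : Fin (k+4)) :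
    y ∈ (Ds S * Th g : PP k) i.succ ↔ i ∉ S ∧ y = (g⁻¹ i).succ := by
  simp only [mem_pmul, mem_Ds_succ]
  constructor
  · rintro ⟨w, ⟨h, rfl⟩, h2⟩; exact ⟨h, (mem_Th_succ _ _ _).1 h2⟩
  · rintro ⟨h, h2⟩; exact ⟨_, ⟨h, rfl⟩, (mem_Th_succ _ _ _).2 h2⟩
theorem n2_zero (S g) (y : Fin (k+4)) : y ∈ (betaTwo (k+4) * (Ds S * Th g) : PP k) 0 ↔ False := by
  rw [mem_pmul]; simp [mem_b2_zero]
theorem n2_succ (S g) (i : Fin (k+3)) (y : Fin (k+4)) :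
    y ∈ (betaTwo (k+4) * (Ds S * Th g) : PP k) i.succ ↔ i ∉ S ∧ y = (g⁻¹ i).succ := by
  rw [mem_pmul]; simp only [mem_b2_succ, exists_eq_left, n1_succ]
theorem cTh_zero (hk) (h) (y : Fin (k+4)) : y ∈ (gammaMap (k+4) hk * Th h : PP k) 0 ↔ y = (h⁻¹ 0).succ := by
  rw [mem_pmul]; simp only [mem_c_zero, exists_eq_left, mem_Th_succ]
theorem cTh_succ (hk) (h) (i : Fin (k+3)) (y : Fin (k+4)) :
    y ∈ (gammaMap (k+4) hk * Th h : PP k) i.succ ↔ i = 0 ∧ y = 0 := by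
  rw [mem_pmul]; simp only [mem_c_succ]
  constructor
  · rintro ⟨w, ⟨h, rfl⟩, h2⟩; exact ⟨h, (mem_Th_zero _ _).1 h2⟩
  · rintro ⟨h, h2⟩; exact ⟨_, ⟨h, rfl⟩, (mem_Th_zero _ _).2 h2⟩
theorem n3_zero (hk) (g h) (y : Fin (k+4)) :
    y ∈ (Th g * gammaMap (k+4) hk * Th h : PP k) 0 ↔ y = (h⁻¹ 0).succ := by
  rw [mul_assoc, mem_pmul]; simp only [mem_Th_zero, exists_eq_left, cTh_zero]
theorem n3_succ (hk) (g h) (i : Fin (k+3)) (y : Fin (k+4)) :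
    y ∈ (Th g * gammaMap (k+4) hk * Th h : PP k) i.succ ↔ i = g 0 ∧ y = 0 := by
  rw [mul_assoc, mem_pmul]; simp only [mem_Th_succ, exists_eq_left, cTh_succ, Perm.inv_eq_iff_eq]
  
theorem n4_zero (hk) (h) (y : Fin (k+4)) :
    y ∈ (Ds Finset.univ * gammaMap (k+4) hk * Th h : PP k) 0 ↔ y = (h⁻¹ 0).succ := by
  rw [mul_assoc, mem_pmul]; simp only [mem_Ds_zero, exists_eq_left, cTh_zero]
theorem n4_succ (hk) (h) (i : Fin (k+3)) (y : Fin (k+4)) :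
    y ∈ (Ds Finset.univ * gammaMap (k+4) hk * Th h : PP k) i.succ ↔ False := by
  rw [mul_assoc, mem_pmul]; simp [mem_Ds_succ]
theorem n5_zero (hk) (g) (y : Fin (k+4)) :
    y ∈ (Th g * (betaTwo (k+4) * gammaMap (k+4) hk) : PP k) 0 ↔ False := by
  simp [mem_pmul, mem_Th_zero, mem_b2_zero]
theorem n5_succ (hk) (g) (i : Fin (k+3)) (y : Fin (k+4)) :
    y ∈ (Th g * (betaTwo (k+4) * gammaMap (k+4) hk) : PP k) i.succ ↔ i = g 0 ∧ y = 0 := by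
  simp only [mem_pmul, mem_Th_succ, exists_eq_left, mem_b2_succ, mem_c_succ, Perm.inv_eq_iff_eq]

end Conc

section RelSec
variable {k : ℕ}

theorem rot_inv_pow (k : ℕ) : (finRotate (k+3))⁻¹ ^ (k+2) = finRotate (k+3) := by
  rw [inv_pow, inv_eq_iff_mul_eq_one, ← pow_succ, rot_pow]

theorem rot_inv_pow_zero (k j : ℕ) (h1 : 1 ≤ j) (h2 : j ≤ k + 2) :
    ((finRotate (k+3))⁻¹ ^ j) 0 = ⟨k + 3 - j, by omega⟩ := by
  have e : (finRotate (k+3))⁻¹ ^ j = finRotate (k+3) ^ (k+3-j) := by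
    rw [inv_pow, inv_eq_iff_mul_eq_one, ← pow_add, Nat.add_sub_cancel' (by omega), rot_pow]
  have e0 := pow_apply_aux (finRotate (k+3)) 0 (fun i h _ => rot_lt k i h) (k+3-j) 0 (by omega) (by omega)
  rw [e]
  refine e0.trans ?_
  ext; simp

theorem rot_zero (k : ℕ) : finRotate (k+3) 0 = 1 := rot_lt k 0 (by omega)

theorem Thc_zero (hk) (g) (y : Fin (k+4)) : y ∈ (Th g * gammaMap (k+4) hk : PP k) 0 ↔ y = Fin.succ 0 := by
  rw [mem_pmul]; simp only [mem_Th_zero, exists_eq_left, mem_c_zero]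
theorem Thc_succ (hk) (g) (i : Fin (k+3)) (y : Fin (k+4)) :
    y ∈ (Th g * gammaMap (k+4) hk : PP k) i.succ ↔ i = g 0 ∧ y = 0 := by
  rw [mem_pmul]; simp only [mem_Th_succ, exists_eq_left, mem_c_succ, Perm.inv_eq_iff_eq]

theorem Thc_congr (hk) (g h : Perm (Fin (k+3))) (e : g 0 = h 0) :
    Th g * gammaMap (k+4) hk = Th h * gammaMap (k+4) hk := by
  apply pext
  · simp [Thc_zero]
  · simp [Thc_succ, e]

theorem cTh_congr (hk) (g h : Perm (Fin (k+3))) (e : g⁻¹ 0 = h⁻¹ 0) :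
    gammaMap (k+4) hk * Th g = gammaMap (k+4) hk * Th h := by
  apply pext
  · simp [cTh_zero, e]
  · simp [cTh_succ]

theorem gg (hk) : gammaMap (k+4) hk * gammaMap (k+4) hk = Ds {0}ᶜ := by
  apply pext
  · intro y
    rw [mem_pmul, mem_Ds_zero]; simp only [mem_c_zero, exists_eq_left, mem_c_succ, true_and]
  · intro i y
    rw [mem_pmul, mem_Ds_succ]
    simp only [mem_c_succ, Finset.mem_compl, Finset.mem_singleton, not_not]
    constructor
    · rintro ⟨w, ⟨rfl, rfl⟩, h2⟩; exact ⟨rfl, (mem_c_zero _ _).1 h2⟩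
    · rintro ⟨rfl, h⟩; exact ⟨0, ⟨rfl, rfl⟩, (mem_c_zero _ _).2 h⟩

theorem image_filter_rot (k j : ℕ) :
    insert (Fin.last (k+2)) ((Finset.univ.filter (fun i : Fin (k+3) => k + 2 ≤ i.val + j)).image
      ((finRotate (k+3))⁻¹ : Perm (Fin (k+3)))) =
    Finset.univ.filter (fun i : Fin (k+3) => k + 2 ≤ i.val + (j+1)) := by
  ext i
  simp only [Finset.mem_insert, Finset.mem_image, Finset.mem_filter, Finset.mem_univ, true_and]
  constructor
  · rintro (rfl | ⟨a, ha, rfl⟩)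
    · simp
    · obtain ⟨i, rfl⟩ := (finRotate (k+3)).surjective a
      have h1 : (finRotate (k+3))⁻¹ (finRotate (k+3) i) = i := by simp
      rw [h1]
      by_cases h : (i : ℕ) = k + 2
      · omega
      · have h2 := rot_lt k i (by omega)
        have h3 : finRotate (k+3) i = ⟨i + 1, by omega⟩ := h2
        rw [h3] at ha
        simp at ha
        omega
  · intro h
    by_cases h' : i = Fin.last (k+2)
    · left; exact h'
    · right
      have : (i : ℕ) ≠ k + 2 := fun h2 => h' (Fin.ext h2)
      refine ⟨finRotate (k+3) i, ?_, by simp⟩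
      have := rot_lt k i (by omega)
      rw [this]
      simp; omega

theorem Ds_pow (k j : ℕ) : (Ds {Fin.last (k+2)} * Th (finRotate (k+3))⁻¹) ^ j * Ds {Fin.last (k+2)} =
    Ds (Finset.univ.filter (fun i => k + 2 ≤ i.val + j)) * Th (finRotate (k+3))⁻¹ ^ j := by
  induction j with
  | zero =>
    rw [pow_zero, pow_zero, one_mul, mul_one]
    congr 1
    ext i
    simp [Fin.ext_iff]
    omega
  | succ j ih =>
    rw [pow_succ', mul_assoc, ih, mul_assoc, ← mul_assoc (Th _), Th_Ds, pow_succ', ← mul_assoc, ← mul_assoc,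
      Ds_mul, mul_assoc, ← Finset.insert_eq, image_filter_rot]

theorem phi_a1 (hk) : phi (k+4) hk wa1 = ThH (finRotate (k+3))⁻¹ := by
  rw [ThH_apply, ← alphaOne_eq hk]; rfl
theorem phi_a2 (hk) : phi (k+4) hk wa2 = ThH (swap 0 1) := by
  rw [ThH_apply, ← alphaTwo_eq hk]; rfl
theorem phi_b1 (hk) : phi (k+4) hk wb1 = Ds {Fin.last (k+2)} := by
  rw [← betaOne_eq]; rfl
theorem phi_b2 (hk) : phi (k+4) hk wb2 = betaTwo (k+4) := rfl
theorem phi_c (hk) : phi (k+4) hk wc = gammaMap (k+4) hk := rfl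

theorem Th_Ds_inv (g : Perm (Fin (k+3))) (S) : ThH g * Ds S * ThH g⁻¹ = Ds (S.image g) := by
  rw [ThH_apply, Th_Ds, mul_assoc, ← ThH_apply, ← map_mul, mul_inv_cancel, map_one, mul_one]

theorem phi_rel (hk) (u v : W) (h : Rrel (k+4) u v) : phi (k+4) hk u = phi (k+4) hk v := by
  have hp := perm_rel k
  have e1 : k + 4 - 1 = k + 3 := rfl
  have e2 : k + 4 - 2 = k + 2 := rfl
  have e3 : k + 4 - 3 = k + 1 := rfl
  have e4 : k + 4 - 4 = k := rfl
  have hr : ThH (finRotate (k+3))⁻¹ ^ (k+2) = ThH (finRotate (k+3)) := by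
    rw [← map_pow, rot_inv_pow]
  have h0 : ThH (finRotate (k+3)) * Ds {Fin.last (k+2)} * ThH (finRotate (k+3))⁻¹ = Ds {0} := by
    rw [Th_Ds_inv, Finset.image_singleton, finRotate_last]
  have d01 : Ds {0} * ThH (swap (0 : Fin (k+3)) 1) * Ds {0} * ThH (swap 0 1) = Ds {0, 1} := by
    rw [mul_assoc, mul_assoc, ← mul_assoc (ThH _)]
    have := Th_Ds_inv (swap (0 : Fin (k+3)) 1) {0}
    rw [swap_inv] at this
    rw [this, Ds_mul]
    congr 1
  have d10 : ThH (swap (0 : Fin (k+3)) 1) * Ds {0} * ThH (swap 0 1) * Ds {0} = Ds {0, 1} := by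
    have := Th_Ds_inv (swap (0 : Fin (k+3)) 1) {0}
    rw [swap_inv] at this
    rw [this, Ds_mul]
    congr 1
    ext; simp [or_comm]
  rcases h with ⟨rfl, rfl⟩ | ⟨rfl, rfl⟩ | ⟨rfl, rfl⟩ | ⟨rfl, rfl⟩ | ⟨j, hj1, hj2, rfl, rfl⟩ | ⟨rfl, rfl⟩ |
    ⟨rfl, rfl⟩ | ⟨rfl, rfl⟩ | ⟨rfl, rfl⟩ | ⟨rfl, rfl⟩ | ⟨rfl, rfl⟩ | ⟨rfl, rfl⟩ | ⟨rfl, rfl⟩ | ⟨rfl, rfl⟩ |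
    ⟨rfl, rfl⟩ | ⟨rfl, rfl⟩ | ⟨rfl, rfl⟩ | ⟨j, hj1, hj2, rfl, rfl⟩ | ⟨rfl, rfl⟩ | ⟨j, hj1, hj2, rfl, rfl⟩ |
    ⟨rfl, rfl⟩ | ⟨rfl, rfl⟩ | ⟨rfl, rfl⟩
  all_goals simp only [map_mul, map_pow, map_one, phi_a1, phi_a2, phi_b1, phi_b2, phi_c, e1, e2, e3, e4, hr]
  · simpa only [map_mul, map_one, pow_two] using congrArg ThH hp.h1
  · simpa only [map_pow, map_one] using congrArg ThH hp.h2
  · simpa only [map_mul, map_pow, map_one] using congrArg ThH hp.h3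
  · simpa only [map_mul, map_pow, map_one, hr] using congrArg ThH hp.h4
  · simpa only [map_mul, map_pow, map_one] using congrArg ThH (hp.h5 j hj1 hj2)
  · rw [pow_two, Ds_mul, Finset.union_self]
  · apply pext
    · simp [pow_two, mem_pmul, mem_b2_zero]
    · simp [pow_two, mem_pmul, mem_b2_succ]
  · rw [ThH_apply, Th_Ds, Finset.image_singleton, swap_apply_of_ne_of_ne]
    · simp [Fin.ext_iff]
    · simp [Fin.ext_iff]
  · rw [ThH_apply, b2_Th]
  · rw [ThH_apply, b2_Th]
  · rw [b2_Ds]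
  · have hs : ThH (finRotate (k+3))⁻¹ * ThH (swap 0 1) * ThH (finRotate (k+3)) =
        ThH (swap (Fin.last (k+2)) 0) := by
      rw [← map_mul, ← map_mul]
      have := Equiv.swap_apply_apply (finRotate (k+3))⁻¹ 0 1
      rw [inv_inv] at this
      rw [← this]
      have h00 : (finRotate (k+3))⁻¹ 0 = Fin.last (k+2) := by rw [Perm.inv_eq_iff_eq, finRotate_last]
      have h11 : (finRotate (k+3))⁻¹ 1 = 0 := by rw [Perm.inv_eq_iff_eq, rot_zero]
      rw [h00, h11]
    rw [h0, hs, mul_assoc, mul_assoc, ← mul_assoc (ThH (finRotate (k+3))⁻¹), hs]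
    have := Th_Ds_inv (swap (Fin.last (k+2)) 0) {Fin.last (k+2)}
    rw [swap_inv, Finset.image_singleton, swap_apply_left] at this
    exact this
  · rw [mul_assoc (ThH (swap 0 1)), mul_assoc (ThH (swap 0 1)), h0, pow_two, pow_two, ← mul_assoc, ← mul_assoc,
      d01, d10]
  · rw [h0, mul_assoc (ThH (swap 0 1)), mul_assoc (ThH (swap 0 1)), h0,
      mul_assoc (Ds {0} * ThH (swap 0 1)), mul_assoc (Ds {0} * ThH (swap 0 1)), h0, pow_two, ← mul_assoc, d10]
    have : Ds {0} * ThH (swap (0 : Fin (k+3)) 1) * Ds {0} = Ds {0, 1} * ThH (swap 0 1) := by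
      rw [← d01, mul_assoc _ _ (ThH (swap 0 1)), ← map_mul, swap_mul_self, map_one, mul_one]
    rw [this, ThH_apply, Ds_Th_congr _ _ 1, ← ThH_apply, map_one, mul_one]
    intro i hi
    simp only [Finset.mem_insert, Finset.mem_singleton, not_or] at hi
    rw [swap_inv, swap_apply_of_ne_of_ne hi.1 hi.2]; simp
  · rw [pow_succ, pow_two, gg]
    apply pext
    · simp [mem_pmul, mem_Ds_zero]
    · intro i y
      rw [mem_pmul]
      simp only [mem_Ds_succ, mem_c_succ, Finset.mem_compl, Finset.mem_singleton, not_not]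
      constructor
      · rintro ⟨w, ⟨rfl, rfl⟩, h2⟩; exact (mem_c_succ _ _ _).1 h2
      · rintro ⟨rfl, h⟩; exact ⟨_, ⟨rfl, rfl⟩, (mem_c_succ _ _ _).2 ⟨rfl, h⟩⟩
  · apply cTh_congr
    rw [inv_inv, swap_inv, swap_apply_left, rot_zero]
  · apply Thc_congr
    rw [swap_apply_left, rot_zero]
  · rw [← map_pow, ← map_mul]
    apply Thc_congr
    rw [Perm.mul_apply, rot_inv_pow_zero _ _ hj1 (by omega)]
    apply swap_apply_of_ne_of_ne
    · simp [Fin.ext_iff]; omega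
    · simp [Fin.ext_iff]; omega
  · have h00 : (finRotate (k+3))⁻¹ 0 = Fin.last (k+2) := by
      rw [Perm.inv_eq_iff_eq, finRotate_last]
    rw [mul_assoc, ThH_apply]
    apply pext
    · intro y
      simp only [mem_pmul (Ds _), mem_pmul (gammaMap _ _), mem_Ds_zero, mem_c_zero, exists_eq_left, mem_b2_succ, Thc_zero]
    · intro i y
      simp only [mem_pmul (Ds _), mem_pmul (gammaMap _ _), mem_Ds_succ, mem_c_succ]
      constructor
      · rintro ⟨w, ⟨h, rfl⟩, h2⟩
        rw [Thc_succ, h00] at h2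
        exact absurd (by simpa using h2.1) h
      · rintro ⟨w, ⟨h, rfl⟩, h2⟩
        exact absurd h2 (by simp [mem_b2_zero])
  · rw [mul_assoc, ← map_pow, ThH_apply]
    have hne := rot_inv_pow_zero k j (by omega) (by omega)
    apply pext
    · intro y
      simp only [mem_pmul (Ds _), mem_Ds_zero, exists_eq_left]
    · intro i y
      simp only [mem_pmul (Ds _), mem_Ds_succ, Finset.mem_singleton]
      constructor
      · rintro ⟨w, ⟨h, rfl⟩, h2⟩; exact h2
      · intro h
        refine ⟨_, ⟨?_, rfl⟩, h⟩
        rw [Thc_succ, hne] at h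
        rw [h.1]
        simp [Fin.ext_iff]; omega
  · rw [pow_two, gg, ThH_apply, Ds_pow, ← ThH_apply, mul_assoc, ← map_pow, ← map_pow, ← map_mul]
    have h2 : (Finset.univ.filter (fun i : Fin (k+3) => k + 2 ≤ i.val + (k+1))) = {0}ᶜ := by
      ext i
      simp only [Finset.mem_filter, Finset.mem_univ, true_and, Finset.mem_compl,
        Finset.mem_singleton, Fin.ext_iff, Fin.val_zero]
      omega
    rw [h2]
    apply Ds_Th_congr
    intro i hi
    have : i = 0 := by simpa using hi
    rw [this, pow_succ', mul_inv_rev, mul_inv_rev, inv_inv, swap_inv, Perm.mul_apply, Perm.mul_apply,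
      swap_apply_left, rot_zero]
  · rw [pow_two, gg]
    apply pext
    · intro y
      rw [mem_pmul, mem_pmul, ThH_apply]
      simp only [mem_b2_zero, cTh_zero, exists_eq_left, mem_c_succ, swap_inv, swap_apply_left]
      simp
    · intro i y
      rw [mem_pmul, mem_pmul, ThH_apply]
      simp only [mem_b2_succ, exists_eq_left, mem_Ds_succ, cTh_succ]
      simp only [Finset.mem_compl, Finset.mem_singleton, not_not]
      constructor
      · rintro ⟨rfl, rfl⟩; exact ⟨0, ⟨rfl, rfl⟩, (mem_c_zero _ _).2 rfl⟩
      · rintro ⟨w, ⟨rfl, rfl⟩, h⟩; exact ⟨rfl, (mem_c_zero _ _).1 h⟩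
  · rw [pow_two, ← mul_assoc]
    apply pext
    · intro y
      simp [mem_pmul, mem_b2_zero]
    · intro i y
      simp only [mem_pmul, mem_b2_succ, exists_eq_left, mem_c_succ]
      constructor
      · rintro ⟨w, ⟨w', ⟨rfl, rfl⟩, h⟩, h2⟩; simp [mem_b2_zero] at h
      · rintro ⟨w', ⟨rfl, rfl⟩, h⟩; simp [mem_b2_zero] at h

end RelSec

section MainSec
variable {k : ℕ}

theorem exists_dat {M : Type*} [Monoid M] (k : ℕ) (f : W →* M)
    (hf : ∀ u v, Rrel (k+4) u v → f u = f v) :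
    ∃ D : Dat k M, D.θ (finRotate (k+3))⁻¹ = f wa1 ∧ D.θ (swap 0 1) = f wa2 ∧ D.b = f wb1 ∧
      D.z = f wb2 ∧ D.c = f wc := by
  have e1 : k + 4 - 1 = k + 3 := rfl
  have e2 : k + 4 - 2 = k + 2 := rfl
  have e3 : k + 4 - 3 = k + 1 := rfl
  have e4 : k + 4 - 4 = k := rfl
  unfold Rrel at hf
  simp only [or_imp, forall_and] at hf
  obtain ⟨r1, r2, r3, r4, r5, r6, r7, r8, r9, r10, r11, r12, r13, r14, r15, -, -, -, r19, -,
    r21, r22, r23⟩ := hf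
  replace r1 := r1 _ _ ⟨rfl, rfl⟩
  replace r2 := r2 _ _ ⟨rfl, rfl⟩
  replace r3 := r3 _ _ ⟨rfl, rfl⟩
  replace r4 := r4 _ _ ⟨rfl, rfl⟩
  replace r5 := fun j h1 h2 => r5 _ _ ⟨j, h1, h2, rfl, rfl⟩
  replace r6 := r6 _ _ ⟨rfl, rfl⟩
  replace r7 := r7 _ _ ⟨rfl, rfl⟩
  replace r8 := r8 _ _ ⟨rfl, rfl⟩
  replace r9 := r9 _ _ ⟨rfl, rfl⟩
  replace r10 := r10 _ _ ⟨rfl, rfl⟩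
  replace r11 := r11 _ _ ⟨rfl, rfl⟩
  replace r12 := r12 _ _ ⟨rfl, rfl⟩
  replace r13 := r13 _ _ ⟨rfl, rfl⟩
  replace r14 := r14 _ _ ⟨rfl, rfl⟩
  replace r15 := r15 _ _ ⟨rfl, rfl⟩
  replace r19 := r19 _ _ ⟨rfl, rfl⟩
  replace r21 := r21 _ _ ⟨rfl, rfl⟩
  replace r22 := r22 _ _ ⟨rfl, rfl⟩
  replace r23 := r23 _ _ ⟨rfl, rfl⟩
  simp only [map_mul, map_pow, map_one, e1, e2, e3, e4] at *
  have hM : MRel k (f wa1) (f wa2) := ⟨by rw [← pow_two, r1], r2, r3, r4, r5⟩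
  obtain ⟨θ, hr, ht⟩ := exists_theta k _ _ hM
  have hr' : θ (finRotate (k+3)) = f wa1 ^ (k+2) := by
    rw [← hr, ← map_pow, rot_inv_pow]
  have hs : θ (finRotate (k+3))⁻¹ * θ (swap 0 1) * θ (finRotate (k+3)) =
      θ (swap (Fin.last (k+2)) 0) := by
    rw [← map_mul, ← map_mul]
    have := Equiv.swap_apply_apply (finRotate (k+3))⁻¹ 0 1
    rw [inv_inv] at this
    rw [← this]
    have h00 : (finRotate (k+3))⁻¹ 0 = Fin.last (k+2) := by rw [Perm.inv_eq_iff_eq, finRotate_last]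
    have h11 : (finRotate (k+3))⁻¹ 1 = 0 := by rw [Perm.inv_eq_iff_eq, rot_zero]
    rw [h00, h11]
  rw [← hr', ← hr, ← ht] at r12 r13 r14
  rw [← hr] at r19 r10 r21
  rw [← ht] at r8 r9 r21 r22
  have hz : ∀ g, f wb2 * θ g = θ g * f wb2 := by
    intro g
    have hg : g ∈ Subgroup.closure {(finRotate (k+3))⁻¹, swap (0 : Fin (k+3)) 1} := by
      rw [perm_gen]; trivial
    induction hg using Subgroup.closure_induction with
    | mem x hx =>
      rcases hx with rfl | rfl
      · exact r10
      · exact r9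
    | one => simp
    | mul x y _ _ hx hy => rw [map_mul, ← mul_assoc, hx, mul_assoc, hy, mul_assoc]
    | inv x _ hx =>
      calc f wb2 * θ x⁻¹ = θ x⁻¹ * (θ x * f wb2) * θ x⁻¹ := by
            rw [← mul_assoc, ← map_mul]; simp
        _ = θ x⁻¹ * f wb2 * (θ x * θ x⁻¹) := by rw [← hx]; simp only [mul_assoc]
        _ = _ := by rw [← map_mul]; simp
  refine ⟨⟨θ, f wb1, f wb2, f wc, ?_, ?_, r8, hz, r11, ?_, ?_, ?_, ?_, r19, ?_, ?_, ?_⟩,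
    hr, ht, rfl, rfl, rfl⟩
  · rw [← pow_two, r6]
  · rw [← pow_two, r7]
  · rw [← r12, ← hs]; simp only [mul_assoc]
  · simp only [pow_two, mul_assoc] at r13 ⊢; exact r13
  · simp only [pow_two, mul_assoc] at r14 ⊢; exact r14
  · rw [← pow_two, ← pow_succ, r15]
  · rw [r21, pow_two]
  · rw [← r22, pow_two]
  · exact (by rw [pow_two, ← mul_assoc] : _ = (f wb2 * f wc) ^ 2).trans r23

theorem conGen_phi (hk) {u v : W} (h : conGen (Rrel (k+4)) u v) : phi (k+4) hk u = phi (k+4) hk v := by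
  have : conGen (Rrel (k+4)) ≤ Con.ker (phi (k+4) hk) := Con.conGen_le.2 (fun u v h => phi_rel hk u v h)
  exact this h

theorem NF_all {M : Type*} [Monoid M] (f : W →* M) (D : Dat k M)
    (h1 : D.θ (finRotate (k+3))⁻¹ = f wa1) (h2 : D.θ (swap 0 1) = f wa2) (h3 : D.b = f wb1)
    (h4 : D.z = f wb2) (h5 : D.c = f wc) (w : W) : ∀ x, D.NF x → D.NF (x * f w) := by
  induction w using FreeMonoid.inductionOn' with
  | one => intro x hx; simpa using hx
  | of_mul g w ih =>
    intro x hx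
    rw [map_mul, ← mul_assoc]
    apply ih
    cases g with
    | a1 => change D.NF (x * f wa1); rw [← h1]; exact D.NF_θ hx _
    | a2 => change D.NF (x * f wa2); rw [← h2]; exact D.NF_θ hx _
    | b1 => change D.NF (x * f wb1); rw [← h3]; exact D.NF_b hx
    | b2 => change D.NF (x * f wb2); rw [← h4]; exact D.NF_z hx
    | c => change D.NF (x * f wc); rw [← h5]; exact D.NF_c hx

section Inj
variable {M : Type*} [Monoid M] (D : Dat k M) (Φ : M →* PP k) (hk : 3 ≤ k + 4)

theorem Phi_E (hθ : ∀ g, Φ (D.θ g) = Th g) (hb : Φ D.b = Ds {Fin.last (k+2)}) (S) :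
    Φ (D.E S) = Ds S := by
  induction S using Finset.induction_on with
  | empty => rw [D.E_empty, map_one, Ds_empty]
  | insert i S _ ih =>
    rw [D.E_insert, map_mul, ih, Dat.e, map_mul, map_mul, hθ, hθ, hb, ← ThH_apply, ← ThH_apply,
      Th_Ds_inv, Ds_mul, Finset.image_singleton, swap_apply_right, Finset.insert_eq]

theorem E_θ_congr (S) (g h : Perm (Fin (k+3))) (H : ∀ i, i ∉ S → g⁻¹ i = h⁻¹ i) :
    D.E S * D.θ g = D.E S * D.θ h := by
  have : g = (g * h⁻¹) * h := by simp
  rw [this, map_mul, ← mul_assoc, D.E_abs]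
  intro x hx
  rw [Perm.mul_apply, ← H x hx]; simp

set_option linter.unusedSimpArgs false in
theorem Phi_inj (hθ : ∀ g, Φ (D.θ g) = Th g) (hb : Φ D.b = Ds {Fin.last (k+2)})
    (hz : Φ D.z = betaTwo (k+4)) (hc : Φ D.c = gammaMap (k+4) hk)
    {x y : M} (hx : D.NF x) (hy : D.NF y) (h : Φ x = Φ y) : x = y := by
  have hE := Phi_E D Φ hθ hb
  have key : ∀ (i : Fin (k+4)) y', y' ∈ Φ x i ↔ y' ∈ Φ y i := by
    intro i y'; rw [h]
  have hS : ∀ (S S' : Finset (Fin (k+3))) (g g' : Perm (Fin (k+3))),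
      (∀ (i : Fin (k+3)) (y' : Fin (k+4)), (i ∉ S ∧ y' = (g⁻¹ i).succ) ↔ (i ∉ S' ∧ y' = (g'⁻¹ i).succ)) →
      D.E S * D.θ g = D.E S' * D.θ g' := by
    intro S S' g g' H
    have : S = S' := by
      ext i
      rw [← not_iff_not]
      constructor
      · intro hi; exact ((H i _).1 ⟨hi, rfl⟩).1
      · intro hi; exact ((H i _).2 ⟨hi, rfl⟩).1
    subst this
    apply E_θ_congr
    intro i hi
    exact Fin.succ_injective _ ((H i _).1 ⟨hi, rfl⟩).2
  have k0 := key 0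
  have k1 := fun i : Fin (k+3) => key i.succ
  clear key h
  cases hx with
  | t1 S g =>
    simp only [map_mul, hθ, hz, hc, hE, n1_zero, n1_succ] at k0 k1
    cases hy with
    | t1 S' g' =>
      simp only [map_mul, hθ, hz, hc, hE, n1_zero, n1_succ] at k0 k1
      exact hS _ _ _ _ k1
    | t2 S' g' =>
      simp only [map_mul, hθ, hz, hc, hE, n2_zero] at k0
      exact absurd ((k0 0).1 rfl) id
    | t3 g' h' =>
      simp only [map_mul, hθ, hz, hc, hE, n3_zero] at k0
      exact absurd ((k0 0).1 rfl) (Fin.succ_ne_zero _).symm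
    | t4 h' =>
      simp only [map_mul, hθ, hz, hc, hE, Dat.Z, n4_zero] at k0
      exact absurd ((k0 0).1 rfl) (Fin.succ_ne_zero _).symm
    | t5 g' =>
      simp only [map_mul, hθ, hz, hc, hE, n5_zero] at k0
      exact absurd ((k0 0).1 rfl) id
  | t2 S g =>
    simp only [map_mul, hθ, hz, hc, hE, n2_zero, n2_succ] at k0 k1
    cases hy with
    | t1 S' g' =>
      simp only [map_mul, hθ, hz, hc, hE, n1_zero] at k0
      exact absurd ((k0 0).2 rfl) id
    | t2 S' g' =>
      simp only [map_mul, hθ, hz, hc, hE, n2_succ] at k0 k1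
      rw [hS _ _ _ _ k1]
    | t3 g' h' =>
      simp only [map_mul, hθ, hz, hc, hE, n3_zero] at k0
      exact absurd ((k0 _).2 rfl) id
    | t4 h' =>
      simp only [map_mul, hθ, hz, hc, hE, Dat.Z, n4_zero] at k0
      exact absurd ((k0 _).2 rfl) id
    | t5 g' =>
      simp only [map_mul, hθ, hz, hc, hE, n5_succ] at k1
      exact absurd ((k1 _ _).2 ⟨rfl, rfl⟩).2 (Fin.succ_ne_zero _).symm
  | t3 g h =>
    simp only [map_mul, hθ, hz, hc, hE, n3_zero, n3_succ] at k0 k1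
    cases hy with
    | t1 S' g' =>
      simp only [map_mul, hθ, hz, hc, hE, n1_zero] at k0
      exact absurd ((k0 0).2 rfl) (Fin.succ_ne_zero _).symm
    | t2 S' g' =>
      simp only [map_mul, hθ, hz, hc, hE, n2_zero] at k0
      exact absurd ((k0 _).1 rfl) id
    | t3 g' h' =>
      simp only [map_mul, hθ, hz, hc, hE, n3_zero, n3_succ] at k0 k1
      rw [D.θ_c_eq g g' ((k1 _ _).1 ⟨rfl, rfl⟩).1, mul_assoc, mul_assoc,
        D.c_θ_eq h h' (Fin.succ_injective _ ((k0 _).1 rfl))]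
    | t4 h' =>
      simp only [map_mul, hθ, hz, hc, hE, Dat.Z, n4_succ] at k1
      exact absurd ((k1 _ _).1 ⟨rfl, rfl⟩) id
    | t5 g' =>
      simp only [map_mul, hθ, hz, hc, hE, n5_zero] at k0
      exact absurd ((k0 _).1 rfl) id
  | t4 h =>
    simp only [map_mul, hθ, hz, hc, hE, Dat.Z, n4_zero, n4_succ] at k0 k1
    cases hy with
    | t1 S' g' =>
      simp only [map_mul, hθ, hz, hc, hE, n1_zero] at k0
      exact absurd ((k0 0).2 rfl) (Fin.succ_ne_zero _).symm
    | t2 S' g' =>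
      simp only [map_mul, hθ, hz, hc, hE, n2_zero] at k0
      exact absurd ((k0 _).1 rfl) id
    | t3 g' h' =>
      simp only [map_mul, hθ, hz, hc, hE, n3_succ] at k1
      exact absurd ((k1 _ _).2 ⟨rfl, rfl⟩) id
    | t4 h' =>
      simp only [map_mul, hθ, hz, hc, hE, Dat.Z, n4_zero] at k0
      rw [mul_assoc, mul_assoc, D.c_θ_eq h h' (Fin.succ_injective _ ((k0 _).1 rfl))]
    | t5 g' =>
      simp only [map_mul, hθ, hz, hc, hE, n5_zero] at k0
      exact absurd ((k0 _).1 rfl) id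
  | t5 g =>
    simp only [map_mul, hθ, hz, hc, hE, n5_zero, n5_succ] at k0 k1
    cases hy with
    | t1 S' g' =>
      simp only [map_mul, hθ, hz, hc, hE, n1_zero] at k0
      exact absurd ((k0 _).2 rfl) id
    | t2 S' g' =>
      simp only [map_mul, hθ, hz, hc, hE, n2_succ] at k1
      exact absurd ((k1 _ _).1 ⟨rfl, rfl⟩).2 (Fin.succ_ne_zero _).symm
    | t3 g' h' =>
      simp only [map_mul, hθ, hz, hc, hE, n3_zero] at k0
      exact absurd ((k0 _).2 rfl) id
    | t4 h' =>
      simp only [map_mul, hθ, hz, hc, hE, Dat.Z, n4_zero] at k0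
      exact absurd ((k0 _).2 rfl) id
    | t5 g' =>
      simp only [map_mul, hθ, hz, hc, hE, n5_succ] at k1
      rw [← mul_assoc, ← mul_assoc, ← D.hzθ, ← D.hzθ, mul_assoc, mul_assoc,
        D.θ_c_eq g g' ((k1 _ _).1 ⟨rfl, rfl⟩).1]

end Inj

theorem part_one (hk) (u v : W) : conGen (Rrel (k+4)) u v ↔ phi (k+4) hk u = phi (k+4) hk v := by
  refine ⟨conGen_phi hk, fun h => ?_⟩
  let C := conGen (Rrel (k+4))
  let f : W →* C.Quotient := C.mk'
  have hf : ∀ u v, Rrel (k+4) u v → f u = f v := fun u v h => (Con.eq C).2 (ConGen.Rel.of u v h)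
  obtain ⟨D, h1, h2, h3, h4, h5⟩ := exists_dat k f hf
  let Φ : C.Quotient →* PP k := C.lift (phi (k+4) hk) (fun u v h => conGen_phi hk h)
  have hΦ : ∀ w, Φ (f w) = phi (k+4) hk w := fun w => rfl
  have hθ : Φ.comp D.θ = ThH := by
    apply MonoidHom.eq_of_eqOn_dense (perm_gen k)
    rintro x (rfl | rfl)
    · rw [MonoidHom.comp_apply, h1, hΦ, phi_a1]
    · rw [MonoidHom.comp_apply, h2, hΦ, phi_a2]
  have hN : ∀ w, D.NF (f w) := fun w => by
    have := NF_all f D h1 h2 h3 h4 h5 w 1 D.NF_one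
    rwa [one_mul] at this
  have := Phi_inj D Φ hk (fun g => DFunLike.congr_fun hθ g) (by rw [h3, hΦ, phi_b1])
    (by rw [h4, hΦ, phi_b2]) (by rw [h5, hΦ, phi_c]) (hN u) (hN v) h
  exact (Con.eq C).1 this

theorem sd00 : starDist (k+4) 0 0 = 0 := by simp [starDist]
theorem sd0s (i : Fin (k+3)) : starDist (k+4) 0 i.succ = 1 := by
  rw [starDist, if_neg (Fin.succ_ne_zero i).symm]; simp
theorem sds0 (i : Fin (k+3)) : starDist (k+4) i.succ 0 = 1 := by
  rw [starDist, if_neg (Fin.succ_ne_zero i)]; simp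
theorem sdss (i j : Fin (k+3)) : starDist (k+4) i.succ j.succ = if i = j then 0 else 2 := by
  simp [starDist]

theorem PI_one : IsStarPI (1 : PP k) := by
  constructor
  · intro x y a hx hy
    rw [mem_pone] at hx hy
    rw [← hx, ← hy]
  · intro x y u v hx hy
    rw [mem_pone] at hx hy
    rw [← hx, ← hy]

theorem PI_mul {p q : PP k} (hp : IsStarPI p) (hq : IsStarPI q) : IsStarPI (p * q) := by
  constructor
  · intro x y a hx hy
    rw [mem_pmul] at hx hy
    obtain ⟨w, h1, h2⟩ := hx
    obtain ⟨w', h1', h2'⟩ := hy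
    obtain rfl := hq.1 h2 h2'
    exact hp.1 h1 h1'
  · intro x y u v hx hy
    rw [mem_pmul] at hx hy
    obtain ⟨w, h1, h2⟩ := hx
    obtain ⟨w', h1', h2'⟩ := hy
    rw [hq.2 h2 h2', hp.2 h1 h1']

theorem PI_intro {p : PP k}
    (h : ∀ x y u v, u ∈ p x → v ∈ p y → starDist (k+4) u v = starDist (k+4) x y) : IsStarPI p := by
  refine ⟨?_, fun x y u v => h x y u v⟩
  intro x y a hx hy
  have := h x y a a hx hy
  by_contra hne
  rw [starDist, starDist, if_pos rfl, if_neg hne] at this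
  split_ifs at this

theorem PI_Th (g : Perm (Fin (k+3))) : IsStarPI (Th g) := by
  apply PI_intro
  intro x y u v hu hv
  induction x using Fin.cases with
  | zero =>
    rw [mem_Th_zero] at hu; subst hu
    induction y using Fin.cases with
    | zero => rw [mem_Th_zero] at hv; rw [hv]
    | succ j => rw [mem_Th_succ] at hv; rw [hv, sd0s, sd0s]
  | succ i =>
    rw [mem_Th_succ] at hu; subst hu
    induction y using Fin.cases with
    | zero => rw [mem_Th_zero] at hv; rw [hv, sds0, sds0]
    | succ j => rw [mem_Th_succ] at hv; rw [hv, sdss, sdss]; simp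

theorem PI_sub {p : PP k} (h : ∀ x u, u ∈ p x → u = x) : IsStarPI p := by
  apply PI_intro
  intro x y u v hu hv
  rw [h _ _ hu, h _ _ hv]

theorem PI_c (hk) : IsStarPI (gammaMap (k+4) hk) := by
  apply PI_intro
  intro x y u v hu hv
  induction x using Fin.cases with
  | zero =>
    rw [mem_c_zero] at hu; subst hu
    induction y using Fin.cases with
    | zero => rw [mem_c_zero] at hv; rw [hv, sdss, sd00, if_pos rfl]
    | succ j => rw [mem_c_succ] at hv; rw [hv.2, sd0s, sds0]
  | succ i =>
    rw [mem_c_succ] at hu; obtain ⟨rfl, rfl⟩ := hu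
    induction y using Fin.cases with
    | zero => rw [mem_c_zero] at hv; rw [hv, sds0, sd0s]
    | succ j => rw [mem_c_succ] at hv; rw [hv.2, hv.1, sdss, sd00, if_pos rfl]

theorem PI_phi (hk) (w : W) : IsStarPI (phi (k+4) hk w) := by
  induction w using FreeMonoid.inductionOn' with
  | one => rw [map_one]; exact PI_one
  | of_mul g w ih =>
    rw [map_mul]
    refine PI_mul ?_ ih
    cases g with
    | a1 => change IsStarPI (phi (k+4) hk wa1); rw [phi_a1]; exact PI_Th _
    | a2 => change IsStarPI (phi (k+4) hk wa2); rw [phi_a2]; exact PI_Th _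
    | b1 =>
      change IsStarPI (phi (k+4) hk wb1); rw [phi_b1]
      refine PI_sub ?_
      rintro x u ⟨_, rfl⟩
      rfl
    | b2 =>
      change IsStarPI (phi (k+4) hk wb2); rw [phi_b2]
      refine PI_sub ?_
      intro x u hu
      induction x using Fin.cases with
      | zero => exact absurd ((mem_b2_zero _).1 hu) id
      | succ i => exact (mem_b2_succ _ _).1 hu
    | c => exact PI_c hk

theorem ext_perm {m : ℕ} (P : Fin m → Fin m → Prop) (h1 : ∀ i j j', P i j → P i j' → j = j')
    (h2 : ∀ i i' j, P i j → P i' j → i = i') : ∃ g : Perm (Fin m), ∀ i j, P i j → g i = j := by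
  classical
  choose f hf using fun i : {i // ∃ j, P i j} => i.2
  have hinj : Function.Injective f := by
    intro a b hab
    have ha := hf a
    rw [hab] at ha
    exact Subtype.ext (h2 _ _ _ ha (hf b))
  let e : {i // ∃ j, P i j} ≃ {x // x ∈ Set.range f} := Equiv.ofInjective f hinj
  refine ⟨e.extendSubtype, fun i j hij => ?_⟩
  rw [Equiv.extendSubtype_apply_of_mem e i ⟨j, hij⟩]
  exact h1 _ _ _ (hf ⟨i, j, hij⟩) hij

theorem leaf_ext {α : PP k} (ha : IsStarPI α) (H : ∀ (i : Fin (k+3)), (0 : Fin (k+4)) ∉ α i.succ) :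
    ∃ (S : Finset (Fin (k+3))) (g : Perm (Fin (k+3))),
      ∀ i y, y ∈ α (Fin.succ i) ↔ i ∉ S ∧ y = (g⁻¹ i).succ := by
  classical
  obtain ⟨g, hg⟩ := ext_perm (fun i j : Fin (k+3) => j.succ ∈ α i.succ)
    (fun i j j' h h' => Fin.succ_injective _ (Part.mem_unique h h'))
    (fun i i' j h h' => Fin.succ_injective _ (ha.1 h h'))
  refine ⟨Finset.univ.filter (fun i => ¬ ∃ y, y ∈ α i.succ), g⁻¹, fun i y => ?_⟩
  simp only [Finset.mem_filter, Finset.mem_univ, true_and, not_not, inv_inv]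
  have key : ∀ y, y ∈ α i.succ → y = (g i).succ := by
    intro y hy
    obtain ⟨j, rfl⟩ := Fin.exists_succ_eq_of_ne_zero (x := y) (by rintro rfl; exact H i hy)
    rw [hg i j hy]
  constructor
  · intro hy; exact ⟨⟨y, hy⟩, key y hy⟩
  · rintro ⟨⟨y', hy'⟩, rfl⟩
    rwa [← key y' hy']

theorem part_two (hk) : Set.range (phi (k+4) hk) = DPSset (k+4) := by
  ext α
  constructor
  · rintro ⟨w, rfl⟩; exact PI_phi hk w
  intro ha
  replace ha : IsStarPI α := ha
  change α ∈ MonoidHom.mrange (phi (k+4) hk)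
  obtain ⟨D, h1, h2, h3, h4, h5⟩ := exists_dat k (phi (k+4) hk).mrangeRestrict
    (fun u v h => Subtype.ext (phi_rel hk u v h))
  have hθ : (Submonoid.subtype _).comp D.θ = ThH := by
    apply MonoidHom.eq_of_eqOn_dense (perm_gen k)
    rintro x (rfl | rfl)
    · rw [MonoidHom.comp_apply, h1, ← phi_a1 hk]; rfl
    · rw [MonoidHom.comp_apply, h2, ← phi_a2 hk]; rfl
  have hb : (Submonoid.subtype (MonoidHom.mrange (phi (k+4) hk))) D.b = Ds {Fin.last (k+2)} := by
    rw [h3, ← phi_b1 hk]; rfl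
  have mT : ∀ g, Th g ∈ MonoidHom.mrange (phi (k+4) hk) := fun g => by
    have : Th g = (D.θ g : PP k) := (DFunLike.congr_fun hθ g).symm
    rw [this]; exact (D.θ g).2
  have mD : ∀ S, Ds S ∈ MonoidHom.mrange (phi (k+4) hk) := fun S => by
    have : (D.E S : PP k) = Ds S := Phi_E D (Submonoid.subtype _) (fun g => DFunLike.congr_fun hθ g) hb S
    rw [← this]; exact (D.E S).2
  have mb : betaTwo (k+4) ∈ MonoidHom.mrange (phi (k+4) hk) := ⟨wb2, rfl⟩
  have mc : gammaMap (k+4) hk ∈ MonoidHom.mrange (phi (k+4) hk) := ⟨wc, rfl⟩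
  by_cases c0 : ∃ y, y ∈ α 0
  · obtain ⟨y, hy⟩ := c0
    have h0 : ∀ y', y' ∈ α 0 ↔ y' = y := fun y' =>
      ⟨fun h => Part.mem_unique h hy, fun h => h ▸ hy⟩
    induction y using Fin.cases with
    | zero =>
      obtain ⟨S, g, hS⟩ := leaf_ext ha (by
        intro i hi
        have := ha.2 hi hy
        rw [sds0, sd00] at this
        omega)
      have : α = Ds S * Th g := by
        apply pext
        · intro y; rw [h0, n1_zero]
        · intro i y; rw [hS, n1_succ]
      rw [this]; exact mul_mem (mD _) (mT _)
    | succ j =>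
      have hz : ∀ (i : Fin (k+3)) y, y ∈ α i.succ → y = 0 := by
        intro i y hi
        have := ha.2 hi hy
        induction y using Fin.cases with
        | zero => rfl
        | succ l => rw [sds0, sdss] at this; split_ifs at this; all_goals omega
      by_cases c1 : ∃ i : Fin (k+3), (0 : Fin (k+4)) ∈ α i.succ
      · obtain ⟨i, hi⟩ := c1
        have : α = Th (swap 0 i) * gammaMap (k+4) hk * Th (swap 0 j) := by
          apply pext
          · intro y; rw [h0, n3_zero, swap_inv, swap_apply_left]
          · intro i' y
            rw [n3_succ, swap_apply_left]
            constructor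
            · intro h
              have := hz _ _ h
              subst this
              exact ⟨Fin.succ_injective _ (ha.1 h hi), rfl⟩
            · rintro ⟨rfl, rfl⟩; exact hi
        rw [this]; exact mul_mem (mul_mem (mT _) mc) (mT _)
      · have : α = Ds Finset.univ * gammaMap (k+4) hk * Th (swap 0 j) := by
          apply pext
          · intro y; rw [h0, n4_zero, swap_inv, swap_apply_left]
          · intro i' y
            rw [n4_succ, iff_false]
            intro h
            exact c1 ⟨i', hz _ _ h ▸ h⟩
        rw [this]; exact mul_mem (mul_mem (mD _) mc) (mT _)
  · have h0 : ∀ y, y ∈ α 0 ↔ False := fun y => ⟨fun h => c0 ⟨y, h⟩, False.elim⟩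
    by_cases c1 : ∃ i : Fin (k+3), (0 : Fin (k+4)) ∈ α i.succ
    · obtain ⟨i, hi⟩ := c1
      have : α = Th (swap 0 i) * (betaTwo (k+4) * gammaMap (k+4) hk) := by
        apply pext
        · intro y; rw [h0, n5_zero]
        · intro i' y
          rw [n5_succ, swap_apply_left]
          constructor
          · intro h
            have hd := ha.2 h hi
            induction y using Fin.cases with
            | zero => exact ⟨Fin.succ_injective _ (ha.1 h hi), rfl⟩
            | succ l => rw [sds0, sdss] at hd; split_ifs at hd; all_goals omega
          · rintro ⟨rfl, rfl⟩; exact hi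
      rw [this]; exact mul_mem (mT _) (mul_mem mb mc)
    · obtain ⟨S, g, hS⟩ := leaf_ext ha (fun i hi => c1 ⟨i, hi⟩)
      have : α = betaTwo (k+4) * (Ds S * Th g) := by
        apply pext
        · intro y; rw [h0, n2_zero]
        · intro i y; rw [hS, n2_succ]
      rw [this]; exact mul_mem mb (mul_mem (mD _) (mT _))

end MainSec

/-- For `n ≥ 4`, the monoid `DPS_n` is defined by the presentation `⟨A | R⟩`:
the congruence generated by `R` is the kernel of `φ`, and the image of `φ`
is exactly `DPS_n`, so that `A*/ρ_R ≅ DPS_n` via the map induced by `φ`. -/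
theorem statement19 (n : ℕ) (hn : 4 ≤ n) :
    (∀ u v : W, conGen (Rrel n) u v ↔ phi n (by omega) u = phi n (by omega) v) ∧
    Set.range (phi n (by omega : (3:ℕ) ≤ n)) = DPSset n := by
  obtain ⟨k, rfl⟩ : ∃ k, n = k + 4 := ⟨n - 4, by omega⟩
  exact ⟨fun u v => part_one _ u v, part_two _⟩

end DPSPaper
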